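/- Let H be a symmetric numerical semigroup minimally generated by n_1, n_2, n_3, n_4, let k be a field, and assume that I_H is not generated by 3 elements (i.e. k[H] is not a complete intersection). Then there exists i ∈ {1,2,3,4} such that Fr(H) + n_i has exactly two factorizations, i.e. the set {(a_1,a_2,a_3,a_4) ∈ ℕ^4 : a_1 n_1 + a_2 n_2 + a_3 n_3 + a_4 n_4 = Fr(H) + n_i} has exactly 2 elements. -/

import Mathlib

/-- A numerical semigroup: a submonoid of `(ℕ, +)` with finite complement. -/
def IsNumericalSemigroup (H : Set ℕ) : Prop :=
  0 ∈ H ∧ (∀ a ∈ H, ∀ b ∈ H, a + b ∈ H) ∧ Hᶜ.Finite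

/-- The Frobenius number of `H ≠ ℕ`: the largest natural number not in `H`. -/
noncomputable def Frob (H : Set ℕ) : ℕ := sSup Hᶜ

/-- The set of pseudo-Frobenius numbers of `H`, as a subset of `ℤ`. -/
def PF (H : Set ℕ) : Set ℤ :=
  {f | f ∉ ((Nat.cast : ℕ → ℤ) '' H) ∧
    ∀ h ∈ H, 0 < h → f + (h : ℤ) ∈ ((Nat.cast : ℕ → ℤ) '' H)}

/-- A symmetric submonoid `M` of `ℤ` generated by positive integers `t, x, y, z`, with Frobenius
number `F`. -/
structure SymmetricMonoid (M : AddSubmonoid ℤ) (t x y z F : ℤ) : Prop where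
  mem_iff : ∀ h, h ∈ M ↔
    ∃ i j k l : ℤ, 0 ≤ i ∧ 0 ≤ j ∧ 0 ≤ k ∧ 0 ≤ l ∧ h = i * t + j * x + k * y + l * z
  t_pos : 0 < t
  x_pos : 0 < x
  y_pos : 0 < y
  z_pos : 0 < z
  mem_iff_dual : ∀ h, h ∈ M ↔ F - h ∉ M

/-- Membership in the Apéry set of `M` with respect to `t`. -/
def Apery (M : AddSubmonoid ℤ) (t h : ℤ) : Prop := h ∈ M ∧ h - t ∉ M

/-- The degree of a monomial with exponent vector `u`. -/
def quadDeg (t x y z : ℤ) (u : ℕ × ℕ × ℕ × ℕ) : ℤ :=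
  u.1 * t + u.2.1 * x + u.2.2.1 * y + u.2.2.2 * z

/-- One of `F + t`, `F + x`, `F + y`, `F + z` has exactly two factorizations. -/
def HasTwoFactorizations (t x y z F : ℤ) : Prop :=
  ∃ g, (g = t ∨ g = x ∨ g = y ∨ g = z) ∧ ∃ p q : ℕ × ℕ × ℕ × ℕ, p ≠ q ∧
    ∀ u, quadDeg t x y z u = F + g ↔ u = p ∨ u = q

/-- The congruence of equality of degrees is generated by three pairs. -/
def ThreeRelated (t x y z : ℤ) : Prop :=
  ∃ p₁ q₁ p₂ q₂ p₃ q₃ : ℕ × ℕ × ℕ × ℕ,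
    quadDeg t x y z p₁ = quadDeg t x y z q₁ ∧ quadDeg t x y z p₂ = quadDeg t x y z q₂ ∧
    quadDeg t x y z p₃ = quadDeg t x y z q₃ ∧
    ∀ C : AddCon (ℕ × ℕ × ℕ × ℕ), C p₁ q₁ → C p₂ q₂ → C p₃ q₃ →
      ∀ u v, quadDeg t x y z u = quadDeg t x y z v → C u v

/-- `c * z` is the least multiple of `z` in the Apéry set that is a combination of `x` and `y`. -/
structure IsMinRel (M : AddSubmonoid ℤ) (t x y z c : ℤ) : Prop where
  pos : 0 < c
  apery : Apery M t (c * z)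
  rel : ∃ a b : ℤ, 0 ≤ a ∧ 0 ≤ b ∧ c * z = a * x + b * y
  eq_zero : ∀ d a b : ℤ, 0 ≤ d → d < c → 0 ≤ a → 0 ≤ b → d * z = a * x + b * y → d = 0

/-- No positive multiple of `z` in the Apéry set is a combination of `x` and `y`. -/
def NoRel (M : AddSubmonoid ℤ) (t x y z : ℤ) : Prop :=
  ∀ d a b : ℤ, 0 ≤ d → Apery M t (d * z) → 0 ≤ a → 0 ≤ b → d * z = a * x + b * y → d = 0

lemma quadDeg_mk (t x y z : ℤ) (i j k l : ℕ) :
    quadDeg t x y z (i, j, k, l) = i * t + j * x + k * y + l * z := rfl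

lemma quadDeg_add (t x y z : ℤ) (u v : ℕ × ℕ × ℕ × ℕ) :
    quadDeg t x y z (u + v) = quadDeg t x y z u + quadDeg t x y z v := by
  simp only [quadDeg, Prod.fst_add, Prod.snd_add]
  push_cast
  ring

lemma HasTwoFactorizations.swap_xy {t x y z F : ℤ} (h : HasTwoFactorizations t y x z F) :
    HasTwoFactorizations t x y z F := by
  obtain ⟨g, hg, ⟨p0, p1, p2, p3⟩, ⟨q0, q1, q2, q3⟩, hpq, H⟩ := h
  refine ⟨g, by tauto, (p0, p2, p1, p3), (q0, q2, q1, q3), ?_, ?_⟩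
  · simp only [ne_eq, Prod.mk.injEq] at hpq ⊢
    tauto
  · rintro ⟨i, j, k, l⟩
    have := H (i, k, j, l)
    simp only [quadDeg_mk, Prod.mk.injEq] at this ⊢
    rw [add_right_comm (_ * t)]
    tauto

lemma HasTwoFactorizations.swap_yz {t x y z F : ℤ} (h : HasTwoFactorizations t x z y F) :
    HasTwoFactorizations t x y z F := by
  obtain ⟨g, hg, ⟨p0, p1, p2, p3⟩, ⟨q0, q1, q2, q3⟩, hpq, H⟩ := h
  refine ⟨g, by tauto, (p0, p1, p3, p2), (q0, q1, q3, q2), ?_, ?_⟩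
  · simp only [ne_eq, Prod.mk.injEq] at hpq ⊢
    tauto
  · rintro ⟨i, j, k, l⟩
    have := H (i, j, l, k)
    simp only [quadDeg_mk, Prod.mk.injEq] at this ⊢
    rw [add_right_comm (_ + _)]
    tauto

/-- Swapping the second and third exponents. -/
def quadSwapXY : ℕ × ℕ × ℕ × ℕ →+ ℕ × ℕ × ℕ × ℕ where
  toFun u := (u.1, u.2.2.1, u.2.1, u.2.2.2)
  map_zero' := rfl
  map_add' _ _ := rfl

/-- Swapping the third and fourth exponents. -/
def quadSwapYZ : ℕ × ℕ × ℕ × ℕ →+ ℕ × ℕ × ℕ × ℕ where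
  toFun u := (u.1, u.2.1, u.2.2.2, u.2.2.1)
  map_zero' := rfl
  map_add' _ _ := rfl

lemma ThreeRelated.of_involutive {t x y z t' x' y' z' : ℤ}
    (f : ℕ × ℕ × ℕ × ℕ →+ ℕ × ℕ × ℕ × ℕ) (hf : ∀ u, f (f u) = u)
    (hdeg : ∀ u, quadDeg t x y z (f u) = quadDeg t' x' y' z' u)
    (h : ThreeRelated t' x' y' z') : ThreeRelated t x y z := by
  obtain ⟨p₁, q₁, p₂, q₂, p₃, q₃, h₁, h₂, h₃, H⟩ := h
  refine ⟨f p₁, f q₁, f p₂, f q₂, f p₃, f q₃, by simp only [hdeg, h₁], by simp only [hdeg, h₂],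
    by simp only [hdeg, h₃], fun C c₁ c₂ c₃ u v huv => ?_⟩
  have := H (C.comap f (map_add f)) c₁ c₂ c₃ (f u) (f v) (by rw [← hdeg, ← hdeg, hf, hf, huv])
  rwa [AddCon.comap_rel, hf, hf] at this

lemma ThreeRelated.swap_xy {t x y z : ℤ} (h : ThreeRelated t y x z) : ThreeRelated t x y z :=
  h.of_involutive quadSwapXY (fun _ => rfl) fun u => by
    simp only [quadSwapXY, quadDeg, AddMonoidHom.coe_mk, ZeroHom.coe_mk]
    ring

lemma ThreeRelated.swap_yz {t x y z : ℤ} (h : ThreeRelated t x z y) : ThreeRelated t x y z :=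
  h.of_involutive quadSwapYZ (fun _ => rfl) fun u => by
    simp only [quadSwapYZ, quadDeg, AddMonoidHom.coe_mk, ZeroHom.coe_mk]
    ring

lemma IsMinRel.swap {M : AddSubmonoid ℤ} {t x y z c : ℤ} (h : IsMinRel M t x y z c) :
    IsMinRel M t y x z c where
  pos := h.pos
  apery := h.apery
  rel := by
    obtain ⟨a, b, ha, hb, e⟩ := h.rel
    exact ⟨b, a, hb, ha, by rw [e, add_comm]⟩
  eq_zero d a b hd hdc ha hb e := h.eq_zero d b a hd hdc hb ha (by rw [e, add_comm])

lemma NoRel.swap {M : AddSubmonoid ℤ} {t x y z : ℤ} (h : NoRel M t x y z) : NoRel M t y x z :=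
  fun d a b hd hA ha hb e => h d b a hd hA hb ha (by rw [e, add_comm])

lemma Apery.of_add {M : AddSubmonoid ℤ} {t u v : ℤ} (h : Apery M t (u + v)) (hu : u ∈ M)
    (hv : v ∈ M) : Apery M t u :=
  ⟨hu, fun h' => h.2 (by have := M.add_mem h' hv; rwa [sub_add_eq_add_sub] at this)⟩

namespace SymmetricMonoid

variable {M : AddSubmonoid ℤ} {t x y z F : ℤ}

lemma swap_xy (S : SymmetricMonoid M t x y z F) : SymmetricMonoid M t y x z F where
  mem_iff h := by
    rw [S.mem_iff]
    constructor <;> rintro ⟨i, j, k, l, hi, hj, hk, hl, e⟩ <;>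
      exact ⟨i, k, j, l, hi, hk, hj, hl, by rw [e]; ring⟩
  t_pos := S.t_pos
  x_pos := S.y_pos
  y_pos := S.x_pos
  z_pos := S.z_pos
  mem_iff_dual := S.mem_iff_dual

lemma swap_yz (S : SymmetricMonoid M t x y z F) : SymmetricMonoid M t x z y F where
  mem_iff h := by
    rw [S.mem_iff]
    constructor <;> rintro ⟨i, j, k, l, hi, hj, hk, hl, e⟩ <;>
      exact ⟨i, j, l, k, hi, hj, hl, hk, by rw [e]; ring⟩
  t_pos := S.t_pos
  x_pos := S.x_pos
  y_pos := S.z_pos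
  z_pos := S.y_pos
  mem_iff_dual := S.mem_iff_dual

lemma mem (S : SymmetricMonoid M t x y z F) {h : ℤ} (i j k l : ℤ) (hi : 0 ≤ i) (hj : 0 ≤ j)
    (hk : 0 ≤ k) (hl : 0 ≤ l) (e : h = i * t + j * x + k * y + l * z) : h ∈ M :=
  (S.mem_iff h).2 ⟨i, j, k, l, hi, hj, hk, hl, e⟩

lemma nonneg_of_mem (S : SymmetricMonoid M t x y z F) {h : ℤ} (hh : h ∈ M) : 0 ≤ h := by
  obtain ⟨i, j, k, l, hi, hj, hk, hl, rfl⟩ := (S.mem_iff h).1 hh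
  have := S.t_pos; have := S.x_pos; have := S.y_pos; have := S.z_pos
  positivity

lemma frob_ne (S : SymmetricMonoid M t x y z F) (i j k l : ℤ) (hi : 0 ≤ i) (hj : 0 ≤ j)
    (hk : 0 ≤ k) (hl : 0 ≤ l) (e : F = i * t + j * x + k * y + l * z) : False := by
  have h0 := (S.mem_iff_dual 0).1 M.zero_mem
  rw [sub_zero] at h0
  exact h0 (S.mem i j k l hi hj hk hl e)

lemma mem_of_dual_notMem (S : SymmetricMonoid M t x y z F) {h : ℤ} (hh : F - h ∉ M) : h ∈ M :=
  (S.mem_iff_dual h).2 hh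

lemma apery_top (S : SymmetricMonoid M t x y z F) : Apery M t (F + t) := by
  refine ⟨S.mem_of_dual_notMem fun h => ?_, fun h => ?_⟩
  · have := S.nonneg_of_mem h
    have := S.t_pos
    omega
  · rw [add_sub_cancel_right] at h
    obtain ⟨i, j, k, l, hi, hj, hk, hl, e⟩ := (S.mem_iff _).1 h
    exact S.frob_ne i j k l hi hj hk hl e

lemma apery_dual (S : SymmetricMonoid M t x y z F) {h : ℤ} (hA : Apery M t h) :
    Apery M t (F + t - h) := by
  refine ⟨S.mem_of_dual_notMem fun h' => hA.2 ?_, fun h' => (S.mem_iff_dual h).1 hA.1 ?_⟩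
  · convert h' using 1; ring
  · convert h' using 1; ring

lemma exists_of_apery (S : SymmetricMonoid M t x y z F) {h : ℤ} (hA : Apery M t h) :
    ∃ j k l : ℤ, 0 ≤ j ∧ 0 ≤ k ∧ 0 ≤ l ∧ h = j * x + k * y + l * z := by
  obtain ⟨i, j, k, l, hi, hj, hk, hl, e⟩ := (S.mem_iff h).1 hA.1
  rcases hi.eq_or_lt with rfl | hi'
  · exact ⟨j, k, l, hj, hk, hl, by rw [e]; ring⟩
  · exact absurd (S.mem (i - 1) j k l (by omega) hj hk hl (by rw [e]; ring)) hA.2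

/-- An element of the Apéry set has no factorization involving `t`. -/
lemma apery_ne (S : SymmetricMonoid M t x y z F) {h : ℤ} (hA : Apery M t h) (i j k l : ℤ)
    (hi : 0 < i) (hj : 0 ≤ j) (hk : 0 ≤ k) (hl : 0 ≤ l)
    (e : h = i * t + j * x + k * y + l * z) : False :=
  hA.2 (S.mem (i - 1) j k l (by omega) hj hk hl (by rw [e]; ring))

lemma apery_of_le (S : SymmetricMonoid M t x y z F) {h : ℤ} (hA : Apery M t h) {u : ℤ}
    (i j k i' j' k' : ℤ) (hi : 0 ≤ i) (hj : 0 ≤ j) (hk : 0 ≤ k) (hi' : i ≤ i') (hj' : j ≤ j')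
    (hk' : k ≤ k') (eu : u = i * x + j * y + k * z) (e : h = i' * x + j' * y + k' * z) :
    Apery M t u := by
  refine Apery.of_add (v := h - u) (by rwa [add_sub_cancel])
    (S.mem 0 i j k le_rfl hi hj hk (by rw [eu]; ring))
    (S.mem 0 (i' - i) (j' - j) (k' - k) le_rfl (by omega) (by omega) (by omega) ?_)
  rw [e, eu]; ring

lemma exists_of_not_apery (S : SymmetricMonoid M t x y z F) {h : ℤ} (hM : h ∈ M)
    (hA : ¬ Apery M t h) :
    ∃ i j k l : ℤ, 0 ≤ i ∧ 0 ≤ j ∧ 0 ≤ k ∧ 0 ≤ l ∧ h = (i + 1) * t + j * x + k * y + l * z := by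
  have : h - t ∈ M := by
    by_contra hc
    exact hA ⟨hM, hc⟩
  obtain ⟨i, j, k, l, hi, hj, hk, hl, e⟩ := (S.mem_iff _).1 this
  exact ⟨i, j, k, l, hi, hj, hk, hl, by linear_combination e⟩

lemma exists_quad_of_not_apery (S : SymmetricMonoid M t x y z F) {h : ℤ} (hM : h ∈ M)
    (hA : ¬ Apery M t h) : ∃ v, h = quadDeg t x y z ((1, 0, 0, 0) + v) := by
  obtain ⟨i, j, k, l, hi, hj, hk, hl, e⟩ := S.exists_of_not_apery hM hA
  lift i to ℕ using hi
  lift j to ℕ using hj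
  lift k to ℕ using hk
  lift l to ℕ using hl
  refine ⟨(i, j, k, l), ?_⟩
  rw [quadDeg_add, quadDeg_mk, quadDeg_mk, e]
  push_cast
  ring

lemma noRel_or_exists_isMinRel (S : SymmetricMonoid M t x y z F) :
    NoRel M t x y z ∨ ∃ c, IsMinRel M t x y z c := by
  classical
  by_cases h : ∃ d : ℕ, 0 < d ∧ Apery M t (d * z) ∧
    ∃ a b : ℤ, 0 ≤ a ∧ 0 ≤ b ∧ (d : ℤ) * z = a * x + b * y
  · right
    obtain ⟨h1, h2, h3⟩ := Nat.find_spec h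
    refine ⟨Nat.find h, by exact_mod_cast h1, h2, h3, fun d a b hd hdc ha hb e => ?_⟩
    lift d to ℕ using hd
    by_contra hd0
    refine Nat.find_min h (by exact_mod_cast hdc) ⟨by omega, ?_, a, b, ha, hb, e⟩
    exact S.apery_of_le h2 0 0 d 0 0 (Nat.find h) le_rfl le_rfl (by omega) le_rfl le_rfl
      (by omega) (by ring) (by ring)
  · left
    intro d a b hd hA ha hb e
    lift d to ℕ using hd
    by_contra hd0
    exact h ⟨d, by omega, hA, a, b, ha, hb, e⟩

/-- The degree congruence is generated by three relations as soon as these connect all monomials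
of a degree in the Apéry set, and make every other monomial a multiple of the first variable. -/
lemma threeRelated_of (S : SymmetricMonoid M t x y z F) (p₁ q₁ p₂ q₂ p₃ q₃ : ℕ × ℕ × ℕ × ℕ)
    (h₁ : quadDeg t x y z p₁ = quadDeg t x y z q₁) (h₂ : quadDeg t x y z p₂ = quadDeg t x y z q₂)
    (h₃ : quadDeg t x y z p₃ = quadDeg t x y z q₃)
    (H : ∀ C : AddCon (ℕ × ℕ × ℕ × ℕ), C p₁ q₁ → C p₂ q₂ → C p₃ q₃ →
      (∀ j k l : ℕ, ¬ Apery M t (j * x + k * y + l * z) →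
        ∃ v, C (0, j, k, l) ((1, 0, 0, 0) + v)) ∧
      ∀ j k l j' k' l' : ℕ, Apery M t (j * x + k * y + l * z) →
        (j * x + k * y + l * z : ℤ) = j' * x + k' * y + l' * z →
        C (0, j, k, l) (0, j', k', l')) :
    ThreeRelated t x y z := by
  refine ⟨p₁, q₁, p₂, q₂, p₃, q₃, h₁, h₂, h₃, fun C c₁ c₂ c₃ => ?_⟩
  let D : AddCon (ℕ × ℕ × ℕ × ℕ) :=
    { r := fun u v => C u v ∧ quadDeg t x y z u = quadDeg t x y z v
      iseqv := ⟨fun u => ⟨C.refl u, rfl⟩, fun h => ⟨C.symm h.1, h.2.symm⟩,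
        fun h h' => ⟨C.trans h.1 h'.1, h.2.trans h'.2⟩⟩
      add' := fun h h' => ⟨C.add h.1 h'.1, by rw [quadDeg_add, quadDeg_add, h.2, h'.2]⟩ }
  obtain ⟨H₁, H₂⟩ := H D ⟨c₁, h₁⟩ ⟨c₂, h₂⟩ ⟨c₃, h₃⟩
  have key : ∀ u, ¬ Apery M t (quadDeg t x y z u) → ∃ v, D u ((1, 0, 0, 0) + v) := by
    rintro ⟨i, j, k, l⟩ hu
    rcases i with _ | i
    · exact H₁ j k l (by convert hu using 2; rw [quadDeg_mk]; push_cast; ring)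
    · refine ⟨(i, j, k, l), ?_⟩
      have : ((i + 1, j, k, l) : ℕ × ℕ × ℕ × ℕ) = (1, 0, 0, 0) + (i, j, k, l) := by
        simp [add_comm]
      rw [this]
      exact D.refl _
  have deg_nonneg : ∀ u, 0 ≤ quadDeg t x y z u := fun u => by
    have := S.t_pos; have := S.x_pos; have := S.y_pos; have := S.z_pos
    unfold quadDeg
    positivity
  suffices h : ∀ N : ℕ, ∀ u v, quadDeg t x y z u < N →
      quadDeg t x y z u = quadDeg t x y z v → D u v from fun u v huv =>
    (h ((quadDeg t x y z u).toNat + 1) u v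
      (by have := deg_nonneg u; push_cast; omega) huv).1
  intro N
  induction N with
  | zero => exact fun u v hu _ => absurd hu (by have := deg_nonneg u; push_cast; omega)
  | succ N ih =>
    intro u v hu huv
    by_cases hA : Apery M t (quadDeg t x y z u)
    · obtain ⟨i, j, k, l⟩ := u
      obtain ⟨i', j', k', l'⟩ := v
      have hA' := hA
      rw [huv] at hA'
      rw [quadDeg_mk] at hA hA'
      have hi : i = 0 := by
        by_contra hi
        exact S.apery_ne hA i j k l (by omega) (by omega) (by omega) (by omega) rfl
      have hi' : i' = 0 := by
        by_contra hi'
        exact S.apery_ne hA' i' j' k' l' (by omega) (by omega) (by omega) (by omega) rfl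
      subst hi hi'
      rw [quadDeg_mk, quadDeg_mk] at huv
      exact H₂ j k l j' k' l' (by convert hA using 1; push_cast; ring)
        (by push_cast at huv; linarith)
    · obtain ⟨u', hu'⟩ := key u hA
      obtain ⟨v', hv'⟩ := key v (huv ▸ hA)
      have ht : quadDeg t x y z (1, 0, 0, 0) = t := by simp [quadDeg]
      have du := hu'.2
      have dv := hv'.2
      rw [quadDeg_add, ht] at du dv
      have := ih u' v' (by have := S.t_pos; push_cast at hu; omega) (by omega)
      exact D.trans hu' (D.trans (D.add (D.refl _) this) (D.symm hv'))

lemma nonneg_and_eq_zero_of_comb (hx : 0 < x) (hy : 0 < y) (hz : 0 < z) {s p q : ℤ}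
    (hp : 0 ≤ p) (hq : 0 ≤ q) (e : s * z = p * x + q * y) :
    0 ≤ s ∧ (s = 0 → p = 0 ∧ q = 0) := by
  have h1 := mul_nonneg hp hx.le
  have h2 := mul_nonneg hq hy.le
  refine ⟨?_, ?_⟩
  · by_contra hs
    have := mul_neg_of_neg_of_pos (not_le.1 hs) hz
    linarith
  · rintro rfl
    have h3 : p * x = 0 := by linarith
    have h4 : q * y = 0 := by linarith
    exact ⟨(mul_eq_zero.1 h3).resolve_right hx.ne', (mul_eq_zero.1 h4).resolve_right hy.ne'⟩

/-- Two factorizations of an element of the Apéry set differ by a multiple of the relation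
`c * z = a * x + b * y` if no relation expresses a multiple of `x` or `y`. -/
lemma exists_shift (S : SymmetricMonoid M t x y z F) {a b c : ℤ} (hz : IsMinRel M t x y z c)
    (ha : 0 ≤ a) (hb : 0 ≤ b) (hr : c * z = a * x + b * y) (hy : NoRel M t x z y)
    (hx : ∀ d b l : ℤ, 0 ≤ d → 0 ≤ b → 0 ≤ l → l < c → Apery M t (d * x) →
      d * x = b * y + l * z → d = 0)
    {i j l i' j' l' : ℤ} (hi : 0 ≤ i) (hj : 0 ≤ j) (hl : 0 ≤ l) (hi' : 0 ≤ i') (hj' : 0 ≤ j')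
    (hl' : 0 ≤ l') (hA : Apery M t (i * x + j * y + l * z))
    (e : i * x + j * y + l * z = i' * x + j' * y + l' * z) :
    ∃ m, i' = i - m * a ∧ j' = j - m * b ∧ l' = l + m * c := by
  have x0 := S.x_pos
  have y0 := S.y_pos
  have z0 := S.z_pos
  have pure_x : ∀ i j l i' j' l' : ℤ, 0 ≤ i → 0 ≤ j → 0 ≤ l → 0 ≤ i' → 0 ≤ j' → 0 ≤ l' → l < c →
      l' < c → Apery M t (i * x + j * y + l * z) →
      i * x + j * y + l * z = i' * x + j' * y + l' * z → j ≤ j' → l ≤ l' →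
      i = i' ∧ j = j' ∧ l = l' := by
    intro i j l i' j' l' hi hj hl hi' hj' hl' hlc hlc' hA e h1 h2
    have e' : (i - i') * x = (j' - j) * y + (l' - l) * z := by linear_combination e
    obtain ⟨n, n'⟩ := nonneg_and_eq_zero_of_comb y0 z0 x0 (by omega) (by omega) e'
    have := hx _ _ _ n (by omega) (by omega) (by omega)
      (S.apery_of_le hA (i - i') 0 0 i j l n le_rfl le_rfl (by omega) hj hl (by ring) rfl) e'
    have := n' this
    omega
  have pure_y : ∀ i j l i' j' l' : ℤ, 0 ≤ i → 0 ≤ j → 0 ≤ l → 0 ≤ i' → 0 ≤ j' → 0 ≤ l' → l < c →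
      l' < c → Apery M t (i * x + j * y + l * z) →
      i * x + j * y + l * z = i' * x + j' * y + l' * z → i ≤ i' → l ≤ l' →
      i = i' ∧ j = j' ∧ l = l' := by
    intro i j l i' j' l' hi hj hl hi' hj' hl' hlc hlc' hA e h1 h2
    have e' : (j - j') * y = (i' - i) * x + (l' - l) * z := by linear_combination e
    obtain ⟨n, n'⟩ := nonneg_and_eq_zero_of_comb x0 z0 y0 (by omega) (by omega) e'
    have := hy _ _ _ n
      (S.apery_of_le hA 0 (j - j') 0 i j l le_rfl n le_rfl hi (by omega) hl (by ring) rfl)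
      (by omega) (by omega) e'
    have := n' this
    omega
  have pure_z : ∀ i j l i' j' l' : ℤ, 0 ≤ i → 0 ≤ j → 0 ≤ l → 0 ≤ i' → 0 ≤ j' → 0 ≤ l' → l < c →
      l' < c → i * x + j * y + l * z = i' * x + j' * y + l' * z → i ≤ i' → j ≤ j' →
      i = i' ∧ j = j' ∧ l = l' := by
    intro i j l i' j' l' hi hj hl hi' hj' hl' hlc hlc' e h1 h2
    have e' : (l - l') * z = (i' - i) * x + (j' - j) * y := by linear_combination e
    obtain ⟨n, n'⟩ := nonneg_and_eq_zero_of_comb x0 y0 z0 (by omega) (by omega) e'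
    have := hz.eq_zero _ _ _ n (by omega) (by omega) (by omega) e'
    have := n' this
    omega
  have reduced : ∀ i j l i' j' l' : ℤ, 0 ≤ i → 0 ≤ j → 0 ≤ l → 0 ≤ i' → 0 ≤ j' → 0 ≤ l' → l < c →
      l' < c → Apery M t (i * x + j * y + l * z) →
      i * x + j * y + l * z = i' * x + j' * y + l' * z → i = i' ∧ j = j' ∧ l = l' := by
    intro i j l i' j' l' hi hj hl hi' hj' hl' hlc hlc' hA e
    have hA' := hA
    rw [e] at hA'
    rcases le_total i i' with h1 | h1 <;> rcases le_total j j' with h2 | h2 <;>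
      rcases le_total l l' with h3 | h3
    · exact pure_z i j l i' j' l' hi hj hl hi' hj' hl' hlc hlc' e h1 h2
    · exact pure_z i j l i' j' l' hi hj hl hi' hj' hl' hlc hlc' e h1 h2
    · exact pure_y i j l i' j' l' hi hj hl hi' hj' hl' hlc hlc' hA e h1 h3
    · have := pure_x i' j' l' i j l hi' hj' hl' hi hj hl hlc' hlc hA' e.symm h2 h3
      omega
    · exact pure_x i j l i' j' l' hi hj hl hi' hj' hl' hlc hlc' hA e h2 h3
    · have := pure_y i' j' l' i j l hi' hj' hl' hi hj hl hlc' hlc hA' e.symm h1 h3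
      omega
    · have := pure_z i' j' l' i j l hi' hj' hl' hi hj hl hlc' hlc e.symm h1 h2
      omega
    · have := pure_z i' j' l' i j l hi' hj' hl' hi hj hl hlc' hlc e.symm h1 h2
      omega
  have c0 := hz.pos
  have q0 := Int.ediv_nonneg hl c0.le
  have q0' := Int.ediv_nonneg hl' c0.le
  have d := Int.mul_ediv_add_emod l c
  have d' := Int.mul_ediv_add_emod l' c
  have r0 := Int.emod_nonneg l c0.ne'
  have r0' := Int.emod_nonneg l' c0.ne'
  have r1 := Int.emod_lt_of_pos l c0
  have r1' := Int.emod_lt_of_pos l' c0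
  have n1 := mul_nonneg q0 ha
  have n2 := mul_nonneg q0 hb
  have n1' := mul_nonneg q0' ha
  have n2' := mul_nonneg q0' hb
  generalize l / c = q at *
  generalize l' / c = q' at *
  generalize l % c = r at *
  generalize l' % c = r' at *
  have E : (i + q * a) * x + (j + q * b) * y + r * z = i * x + j * y + l * z := by
    linear_combination z * d - q * hr
  have E' : (i' + q' * a) * x + (j' + q' * b) * y + r' * z = i' * x + j' * y + l' * z := by
    linear_combination z * d' - q' * hr
  obtain ⟨g1, g2, g3⟩ := reduced _ _ _ _ _ _ (by omega) (by omega) r0 (by omega) (by omega) r0' r1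
    r1' (by rwa [E]) (E.trans (e.trans E'.symm))
  exact ⟨q' - q, by linear_combination -g1, by linear_combination -g2,
    by linear_combination d - d' - g3⟩

/-- `F + t` has a factorization in which the exponent of `z` is less than `c`. -/
lemma exists_top (S : SymmetricMonoid M t x y z F) {a b c : ℤ} (hz : IsMinRel M t x y z c)
    (ha : 0 ≤ a) (hb : 0 ≤ b) (hr : c * z = a * x + b * y) :
    ∃ P Q r : ℤ, 0 ≤ P ∧ 0 ≤ Q ∧ 0 ≤ r ∧ r < c ∧ F + t = P * x + Q * y + r * z := by
  obtain ⟨i, j, l, hi, hj, hl, e⟩ := S.exists_of_apery S.apery_top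
  have c0 := hz.pos
  have q0 := Int.ediv_nonneg hl c0.le
  have d := Int.mul_ediv_add_emod l c
  have n1 := mul_nonneg q0 ha
  have n2 := mul_nonneg q0 hb
  exact ⟨i + l / c * a, j + l / c * b, l % c, by omega, by omega, Int.emod_nonneg l c0.ne',
    Int.emod_lt_of_pos l c0, by linear_combination e - z * d + (l / c) * hr⟩

/-- A monomial of degree in the Apéry set divides one of degree `F + t`. -/
lemma exists_ge_of_apery (S : SymmetricMonoid M t x y z F) {i j l : ℤ}
    (hA : Apery M t (i * x + j * y + l * z)) :
    ∃ i' j' l', i ≤ i' ∧ j ≤ j' ∧ l ≤ l' ∧ F + t = i' * x + j' * y + l' * z := by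
  obtain ⟨i', j', l', hi, hj, hl, e⟩ := S.exists_of_apery (S.apery_dual hA)
  exact ⟨i + i', j + j', l + l', by omega, by omega, by omega, by linear_combination e⟩

/-- Without relations in the Apéry set of `t`, three relations suffice. -/
lemma threeRelated_of_noRel (S : SymmetricMonoid M t x y z F) (hx : NoRel M t y z x)
    (hy : NoRel M t x z y) (hz : NoRel M t x y z) : ThreeRelated t x y z := by
  have x0 := S.x_pos
  have y0 := S.y_pos
  have z0 := S.z_pos
  have uniq : ∀ i j l i' j' l' : ℤ, 0 ≤ i → 0 ≤ j → 0 ≤ l → 0 ≤ i' → 0 ≤ j' → 0 ≤ l' →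
      Apery M t (i * x + j * y + l * z) →
      i * x + j * y + l * z = i' * x + j' * y + l' * z → i = i' ∧ j = j' ∧ l = l' := by
    have pure_x : ∀ i j l i' j' l' : ℤ, 0 ≤ i → 0 ≤ j → 0 ≤ l → 0 ≤ i' → 0 ≤ j' → 0 ≤ l' →
        Apery M t (i * x + j * y + l * z) →
        i * x + j * y + l * z = i' * x + j' * y + l' * z → j ≤ j' → l ≤ l' →
        i = i' ∧ j = j' ∧ l = l' := by
      intro i j l i' j' l' hi hj hl hi' hj' hl' hA e h1 h2
      have e' : (i - i') * x = (j' - j) * y + (l' - l) * z := by linear_combination e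
      obtain ⟨n, n'⟩ := nonneg_and_eq_zero_of_comb y0 z0 x0 (by omega) (by omega) e'
      have := hx _ _ _ n
        (S.apery_of_le hA (i - i') 0 0 i j l n le_rfl le_rfl (by omega) hj hl (by ring) rfl)
        (by omega) (by omega) e'
      have := n' this
      omega
    have pure_y : ∀ i j l i' j' l' : ℤ, 0 ≤ i → 0 ≤ j → 0 ≤ l → 0 ≤ i' → 0 ≤ j' → 0 ≤ l' →
        Apery M t (i * x + j * y + l * z) →
        i * x + j * y + l * z = i' * x + j' * y + l' * z → i ≤ i' → l ≤ l' →
        i = i' ∧ j = j' ∧ l = l' := by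
      intro i j l i' j' l' hi hj hl hi' hj' hl' hA e h1 h2
      have e' : (j - j') * y = (i' - i) * x + (l' - l) * z := by linear_combination e
      obtain ⟨n, n'⟩ := nonneg_and_eq_zero_of_comb x0 z0 y0 (by omega) (by omega) e'
      have := hy _ _ _ n
        (S.apery_of_le hA 0 (j - j') 0 i j l le_rfl n le_rfl hi (by omega) hl (by ring) rfl)
        (by omega) (by omega) e'
      have := n' this
      omega
    have pure_z : ∀ i j l i' j' l' : ℤ, 0 ≤ i → 0 ≤ j → 0 ≤ l → 0 ≤ i' → 0 ≤ j' → 0 ≤ l' →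
        Apery M t (i * x + j * y + l * z) →
        i * x + j * y + l * z = i' * x + j' * y + l' * z → i ≤ i' → j ≤ j' →
        i = i' ∧ j = j' ∧ l = l' := by
      intro i j l i' j' l' hi hj hl hi' hj' hl' hA e h1 h2
      have e' : (l - l') * z = (i' - i) * x + (j' - j) * y := by linear_combination e
      obtain ⟨n, n'⟩ := nonneg_and_eq_zero_of_comb x0 y0 z0 (by omega) (by omega) e'
      have := hz _ _ _ n
        (S.apery_of_le hA 0 0 (l - l') i j l le_rfl le_rfl n hi hj (by omega) (by ring) rfl)
        (by omega) (by omega) e'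
      have := n' this
      omega
    intro i j l i' j' l' hi hj hl hi' hj' hl' hA e
    have hA' := hA
    rw [e] at hA'
    rcases le_total i i' with h1 | h1 <;> rcases le_total j j' with h2 | h2 <;>
      rcases le_total l l' with h3 | h3
    · exact pure_z i j l i' j' l' hi hj hl hi' hj' hl' hA e h1 h2
    · exact pure_z i j l i' j' l' hi hj hl hi' hj' hl' hA e h1 h2
    · exact pure_y i j l i' j' l' hi hj hl hi' hj' hl' hA e h1 h3
    · have := pure_x i' j' l' i j l hi' hj' hl' hi hj hl hA' e.symm h2 h3
      omega
    · exact pure_x i j l i' j' l' hi hj hl hi' hj' hl' hA e h2 h3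
    · have := pure_y i' j' l' i j l hi' hj' hl' hi hj hl hA' e.symm h1 h3
      omega
    · have := pure_z i' j' l' i j l hi' hj' hl' hi hj hl hA' e.symm h1 h2
      omega
    · have := pure_z i' j' l' i j l hi' hj' hl' hi hj hl hA' e.symm h1 h2
      omega
  obtain ⟨P, Q, R, hP, hQ, hR, e⟩ := S.exists_of_apery S.apery_top
  have hA := S.apery_top
  rw [e] at hA
  have top : ∀ i j l : ℤ, 0 ≤ i → 0 ≤ j → 0 ≤ l → Apery M t (i * x + j * y + l * z) →
      i ≤ P ∧ j ≤ Q ∧ l ≤ R := by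
    intro i j l hi hj hl h
    obtain ⟨i', j', l', h1, h2, h3, e'⟩ := S.exists_ge_of_apery h
    have := uniq P Q R i' j' l' hP hQ hR (by omega) (by omega) (by omega) hA (e ▸ e')
    omega
  lift P to ℕ using hP
  lift Q to ℕ using hQ
  lift R to ℕ using hR
  obtain ⟨v₁, h₁⟩ := S.exists_quad_of_not_apery (h := (P + 1) * x + 0 * y + 0 * z)
    (S.mem 0 (P + 1) 0 0 le_rfl (by omega) le_rfl le_rfl (by ring))
    (fun h => by have := top _ _ _ (by omega) le_rfl le_rfl h; omega)
  obtain ⟨v₂, h₂⟩ := S.exists_quad_of_not_apery (h := 0 * x + (Q + 1) * y + 0 * z)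
    (S.mem 0 0 (Q + 1) 0 le_rfl le_rfl (by omega) le_rfl (by ring))
    (fun h => by have := top _ _ _ le_rfl (by omega) le_rfl h; omega)
  obtain ⟨v₃, h₃⟩ := S.exists_quad_of_not_apery (h := 0 * x + 0 * y + (R + 1) * z)
    (S.mem 0 0 0 (R + 1) le_rfl le_rfl le_rfl (by omega) (by ring))
    (fun h => by have := top _ _ _ le_rfl le_rfl (by omega) h; omega)
  refine S.threeRelated_of (0, P + 1, 0, 0) _ (0, 0, Q + 1, 0) _ (0, 0, 0, R + 1) _
    (Eq.trans ?_ h₁) (Eq.trans ?_ h₂) (Eq.trans ?_ h₃) fun C c₁ c₂ c₃ => ⟨fun j k l h => ?_,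
      fun j k l j' k' l' h e' => ?_⟩
  · rw [quadDeg_mk]; push_cast; ring
  · rw [quadDeg_mk]; push_cast; ring
  · rw [quadDeg_mk]; push_cast; ring
  · have : P + 1 ≤ j ∨ Q + 1 ≤ k ∨ R + 1 ≤ l := by
      by_contra! hc
      refine h (S.apery_of_le hA j k l P Q R ?_ ?_ ?_ ?_ ?_ ?_ rfl rfl) <;> omega
    rcases this with h' | h' | h'
    · obtain ⟨d, rfl⟩ := Nat.exists_eq_add_of_le h'
      exact ⟨v₁ + (0, d, k, l), by simpa [add_assoc] using C.add c₁ (C.refl (0, d, k, l))⟩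
    · obtain ⟨d, rfl⟩ := Nat.exists_eq_add_of_le h'
      exact ⟨v₂ + (0, j, d, l), by simpa [add_assoc] using C.add c₂ (C.refl (0, j, d, l))⟩
    · obtain ⟨d, rfl⟩ := Nat.exists_eq_add_of_le h'
      exact ⟨v₃ + (0, j, k, d), by simpa [add_assoc] using C.add c₃ (C.refl (0, j, k, d))⟩
  · have := uniq j k l j' k' l' (by omega) (by omega) (by omega) (by omega) (by omega) (by omega)
      h e'
    rw [show j = j' by omega, show k = k' by omega, show l = l' by omega]
    exact C.refl _

lemma exists_of_isMinRel (S : SymmetricMonoid M t x y z F) {a b c : ℤ}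
    (hz : IsMinRel M t x y z c) (ha : 0 ≤ a) (hb : 0 < b) (hr : c * z = a * x + b * y) :
    ∃ s e : ℤ, 0 ≤ s ∧ 0 ≤ e ∧ F + y + z - c * z = s * t + e * x := by
  have c0 := hz.pos
  have hM : F + y + z - c * z ∈ M := by
    refine S.mem_of_dual_notMem fun h => ?_
    obtain ⟨i, j, k, l, hi, hj, hk, hl, e⟩ := (S.mem_iff _).1 h
    rcases hi.eq_or_lt with rfl | hi'
    · have e' : (c - 1 - l) * z = j * x + (k + 1) * y := by linear_combination e
      obtain ⟨n, n'⟩ := nonneg_and_eq_zero_of_comb S.x_pos S.y_pos S.z_pos hj (by omega) e'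
      have := n' (hz.eq_zero _ _ _ n (by omega) hj (by omega) e')
      omega
    · exact S.apery_ne hz.apery i j (k + 1) (l + 1) hi' hj (by omega) (by omega)
        (by linear_combination e)
  obtain ⟨i, j, k, l, hi, hj, hk, hl, e⟩ := (S.mem_iff _).1 hM
  rcases hk.eq_or_lt with rfl | hk'
  · rcases hl.eq_or_lt with rfl | hl'
    · exact ⟨i, j, hi, hj, by linear_combination e⟩
    · exact (S.frob_ne i (j + a) (b - 1) (l - 1) hi (by omega) (by omega) (by omega)
        (by linear_combination e + hr)).elim
  · exact (S.frob_ne i j (k - 1) (l + c - 1) hi hj (by omega) (by omega)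
      (by linear_combination e)).elim

lemma false_of_isMinRel_of_le (S : SymmetricMonoid M t x y z F) {a b c α β γ s e s' e' : ℤ}
    (hz : IsMinRel M t x y z c) (hy : IsMinRel M t x z y β) (ha : 0 ≤ a) (hb : 0 < b)
    (hr : c * z = a * x + b * y) (hα : 0 ≤ α) (hγ : 0 < γ) (hr' : β * y = α * x + γ * z)
    (hbβ : b < β) (hγc : γ < c) (he : 0 ≤ e) (h : F + y + z - c * z = s * t + e * x)
    (hs' : 0 ≤ s') (h' : F + y + z - β * y = s' * t + e' * x) (hss : s' ≤ s) : False := by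
  have c0 := hz.pos
  rcases hss.eq_or_lt with rfl | hss
  · rcases le_total e' e with hee | hee
    · have := hy.eq_zero (β - b) (a + (e - e')) 0 (by omega) (by omega) (by omega) le_rfl
        (by linear_combination h - h' + hr)
      omega
    · have := hz.eq_zero (c - γ) (α + (e' - e)) 0 (by omega) (by omega) (by omega) le_rfl
        (by linear_combination h' - h + hr')
      omega
  · rcases le_or_gt e' e with hee | hee
    · exact S.apery_ne hy.apery (s - s') (e - e') 0 c (by omega) (by omega) le_rfl c0.le
        (by linear_combination h - h')
    · rcases lt_or_ge (e' - e) a with hj | hj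
      · exact S.apery_ne (S.apery_of_le hy.apery (u := (β - b) * y) 0 (β - b) 0 0 β 0 le_rfl
          (by omega) le_rfl le_rfl (by omega) le_rfl (by ring) (by ring))
          (s - s') (a - (e' - e)) 0 0 (by omega) (by omega) le_rfl le_rfl
          (by linear_combination h - h' + hr)
      · exact S.frob_ne s' (e + (e' - e - a)) (β - b - 1) (c - 1) hs' (by omega) (by omega)
          (by omega) (by linear_combination h' - hr)

/-- Minimal relations for `y` and `z` that involve each other have the same degree. -/
lemma mul_eq_mul_of_isMinRel (S : SymmetricMonoid M t x y z F) {a b c α β γ : ℤ}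
    (hz : IsMinRel M t x y z c) (hy : IsMinRel M t x z y β) (ha : 0 ≤ a) (hb : 0 < b)
    (hr : c * z = a * x + b * y) (hα : 0 ≤ α) (hγ : 0 < γ) (hr' : β * y = α * x + γ * z) :
    c * z = β * y := by
  by_contra hne
  have hbβ : b < β := by
    by_contra! hbβ
    rcases lt_or_ge γ c with hγc | hγc
    · have := hz.eq_zero (c - γ) (a + α) (b - β) (by omega) (by omega) (by omega) (by omega)
        (by linear_combination hr + hr')
      omega
    · have e0 : (0 : ℤ) = (a + α) * x + (b - β) * y + (γ - c) * z := by
        linear_combination hr + hr'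
      have h1 := mul_nonneg (add_nonneg ha hα) S.x_pos.le
      have h2 := mul_nonneg (sub_nonneg.2 hbβ) S.y_pos.le
      have h3 := mul_nonneg (sub_nonneg.2 hγc) S.z_pos.le
      have h4 : (b - β) * y = 0 := by linarith
      have h5 : a * x = 0 := by
        have := mul_nonneg ha S.x_pos.le
        have := mul_nonneg hα S.x_pos.le
        rw [add_mul] at h1 e0
        linarith
      exact hne (by linear_combination hr + h4 + h5)
  have hγc : γ < c := by
    by_contra! hγc
    have := hy.eq_zero (β - b) (a + α) (γ - c) (by omega) (by omega) (by omega) (by omega)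
      (by linear_combination hr + hr')
    omega
  obtain ⟨s, e, hs, he, h⟩ := S.exists_of_isMinRel hz ha hb hr
  obtain ⟨s', e', hs', he', h'⟩ := S.swap_yz.exists_of_isMinRel hy hα hγ hr'
  rcases le_total s' s with hss | hss
  · exact S.false_of_isMinRel_of_le (e' := e') hz hy ha hb hr hα hγ hr' hbβ hγc he h hs'
      (by linear_combination h') hss
  · exact S.swap_yz.false_of_isMinRel_of_le (e' := e) hy hz hα hγ hr' ha hb hr hγc hbβ he' h' hs
      (by linear_combination h) hss

lemma hasTwoFactorizations_of {g i j k l i' j' k' l' : ℤ} (hg : g = t ∨ g = x ∨ g = y ∨ g = z)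
    (hi : 0 ≤ i) (hj : 0 ≤ j) (hk : 0 ≤ k) (hl : 0 ≤ l) (hi' : 0 ≤ i') (hj' : 0 ≤ j')
    (hk' : 0 ≤ k') (hl' : 0 ≤ l') (hne : i ≠ i' ∨ l ≠ l')
    (e : F + g = i * t + j * x + k * y + l * z) (e' : F + g = i' * t + j' * x + k' * y + l' * z)
    (H : ∀ u v w m : ℤ, 0 ≤ u → 0 ≤ v → 0 ≤ w → 0 ≤ m → F + g = u * t + v * x + w * y + m * z →
      u = i ∧ v = j ∧ w = k ∧ m = l ∨ u = i' ∧ v = j' ∧ w = k' ∧ m = l') :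
    HasTwoFactorizations t x y z F := by
  lift i to ℕ using hi
  lift j to ℕ using hj
  lift k to ℕ using hk
  lift l to ℕ using hl
  lift i' to ℕ using hi'
  lift j' to ℕ using hj'
  lift k' to ℕ using hk'
  lift l' to ℕ using hl'
  refine ⟨g, hg, (i, j, k, l), (i', j', k', l'), fun h => ?_, ?_⟩
  · simp only [Prod.mk.injEq] at h
    omega
  · rintro ⟨u, v, w, m⟩
    simp only [Prod.mk.injEq, quadDeg_mk]
    constructor
    · intro h
      have := H u v w m (by omega) (by omega) (by omega) (by omega) h.symm
      omega
    · rintro (⟨rfl, rfl, rfl, rfl⟩ | ⟨rfl, rfl, rfl, rfl⟩)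
      exacts [e.symm, e'.symm]

lemma pos_of_noRel_of_isMinRel {c : ℤ} (hz : IsMinRel M t x y z c) (hx : NoRel M t y z x)
    (z0 : 0 < z) {a b : ℤ} (ha : 0 ≤ a) (hb : 0 ≤ b) (hr : c * z = a * x + b * y) : 0 < b := by
  rcases hb.eq_or_lt with rfl | hb
  · have hA := hz.apery
    have c0 := mul_pos hz.pos z0
    rw [hr, zero_mul, add_zero] at hA
    have := hx a 0 c ha hA le_rfl hz.pos.le (by linear_combination -hr)
    subst this
    linarith
  · exact hb

/-- The exponents of a monomial of degree in the Apéry set are bounded by those of one of the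
factorizations of `F + t`, which form a chain starting at `(P, Q, r)`. -/
lemma exists_le_of_apery (S : SymmetricMonoid M t x y z F) {a b c P Q r : ℤ}
    (hz : IsMinRel M t x y z c) (ha : 0 ≤ a) (hb : 0 ≤ b) (hr : c * z = a * x + b * y)
    (hy : NoRel M t x z y)
    (hx : ∀ d b l : ℤ, 0 ≤ d → 0 ≤ b → 0 ≤ l → l < c → Apery M t (d * x) →
      d * x = b * y + l * z → d = 0)
    (hP : 0 ≤ P) (hQ : 0 ≤ Q) (hr0 : 0 ≤ r) (hrc : r < c) (e : F + t = P * x + Q * y + r * z)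
    {i j l : ℤ} (hi : 0 ≤ i) (hj : 0 ≤ j) (hl : 0 ≤ l) (hA : Apery M t (i * x + j * y + l * z)) :
    ∃ m, 0 ≤ m ∧ i ≤ P - m * a ∧ j ≤ Q - m * b ∧ l ≤ r + m * c := by
  obtain ⟨i', j', l', h1, h2, h3, e'⟩ := S.exists_ge_of_apery hA
  obtain ⟨m, rfl, rfl, rfl⟩ := S.exists_shift hz ha hb hr hy hx hP hQ hr0
    (hi.trans h1) (hj.trans h2) (hl.trans h3) (e ▸ S.apery_top) (e ▸ e')
  refine ⟨m, ?_, h1, h2, h3⟩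
  by_contra! hm
  have : (m + 1) * c ≤ 0 := mul_nonpos_of_nonpos_of_nonneg (by omega) hz.pos.le
  rw [add_mul] at this
  omega

lemma shift_addCon (C : AddCon (ℕ × ℕ × ℕ × ℕ)) {a b c : ℕ} (h : C (0, 0, 0, c) (0, a, b, 0))
    (j k l m : ℕ) : C (0, j, k, l + m * c) (0, j + m * a, k + m * b, l) := by
  simpa using C.add (C.refl (0, j, k, l)) (C.nsmul m h)

lemma addCon_of_shift (C : AddCon (ℕ × ℕ × ℕ × ℕ)) {a b c : ℕ} (h : C (0, 0, 0, c) (0, a, b, 0))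
    {j k l j' k' l' : ℕ} {m : ℤ} (h1 : (j' : ℤ) = j - m * a) (h2 : (k' : ℤ) = k - m * b)
    (h3 : (l' : ℤ) = l + m * c) : C (0, j, k, l) (0, j', k', l') := by
  rcases le_total 0 m with hm | hm
  · lift m to ℕ using hm
    have := shift_addCon C h j' k' l m
    rw [show l + m * c = l' by zify; omega, show j' + m * a = j by zify; omega,
      show k' + m * b = k by zify; omega] at this
    exact C.symm this
  · obtain ⟨m, rfl⟩ : ∃ n : ℕ, m = -n := ⟨m.natAbs, by omega⟩
    rw [neg_mul] at h1 h2 h3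
    have := shift_addCon C h j k l' m
    rwa [show l' + m * c = l by zify; omega, show j + m * a = j' by zify; omega,
      show k + m * b = k' by zify; omega] at this

lemma hasTwoFactorizations_of_lt (S : SymmetricMonoid M t x y z F) {a b c P Q r : ℤ}
    (hz : IsMinRel M t x y z c) (hx : NoRel M t y z x) (hy : NoRel M t x z y) (ha : 0 < a)
    (hb : 0 < b) (hr : c * z = a * x + b * y) (hPa : a ≤ P) (hQb : b ≤ Q) (hr0 : 0 ≤ r)
    (hrc : r < c) (e : F + t = P * x + Q * y + r * z) (h : ¬ (2 * a ≤ P ∧ 2 * b ≤ Q)) :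
    HasTwoFactorizations t x y z F := by
  have c0 := hz.pos
  refine hasTwoFactorizations_of (g := t) (by simp) (i := 0) (j := P) (k := Q) (l := r)
    (i' := 0) (j' := P - a) (k' := Q - b) (l' := r + c) le_rfl (by omega) (by omega) hr0 le_rfl
    (by omega) (by omega) (by omega) (by omega) (by linear_combination e)
    (by linear_combination e - hr) fun u v w m hu hv hw hm e' => ?_
  rcases hu.eq_or_lt with rfl | hu
  · obtain ⟨n, rfl, rfl, rfl⟩ := S.exists_shift hz ha.le hb.le hr hy
      (fun d b l hd hb hl _ hA e => hx d b l hd hA hb hl e) (ha.le.trans hPa) (hb.le.trans hQb) hr0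
      hv hw hm (e ▸ S.apery_top) (e ▸ e'.trans (by ring))
    have n0 : 0 ≤ n := by
      by_contra! hn
      have : (n + 1) * c ≤ 0 := mul_nonpos_of_nonpos_of_nonneg (by omega) c0.le
      rw [add_mul] at this
      omega
    have n1 : n ≤ 1 := by
      by_contra! hn
      exact h ⟨by nlinarith, by nlinarith⟩
    interval_cases n <;> simp
  · exact (S.apery_ne S.apery_top u v w m hu hv hw hm e').elim

lemma threeRelated_of_succ_eq (S : SymmetricMonoid M t x y z F) {a b c P Q r : ℤ}
    (hz : IsMinRel M t x y z c) (hx : NoRel M t y z x) (hy : NoRel M t x z y) (ha : 0 ≤ a)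
    (hb : 0 ≤ b) (hr : c * z = a * x + b * y) (hP : 0 ≤ P) (hQ : 0 ≤ Q) (hr0 : 0 ≤ r)
    (hrc : r + 1 = c) (e : F + t = P * x + Q * y + r * z) : ThreeRelated t x y z := by
  have hx' : ∀ d b l : ℤ, 0 ≤ d → 0 ≤ b → 0 ≤ l → l < c → Apery M t (d * x) →
      d * x = b * y + l * z → d = 0 := fun d b l hd hb hl _ hA e => hx d b l hd hA hb hl e
  have c0 := hz.pos
  have top : ∀ i j l : ℤ, 0 ≤ i → 0 ≤ j → 0 ≤ l → Apery M t (i * x + j * y + l * z) →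
      i ≤ P ∧ j ≤ Q := by
    intro i j l hi hj hl h
    obtain ⟨m, hm, h1, h2, -⟩ := S.exists_le_of_apery hz ha hb hr hy hx' hP hQ hr0 (by omega) e hi
      hj hl h
    have := mul_nonneg hm ha
    have := mul_nonneg hm hb
    omega
  lift P to ℕ using hP
  lift Q to ℕ using hQ
  lift a to ℕ using ha
  lift b to ℕ using hb
  lift c to ℕ using c0.le
  obtain ⟨v₂, h₂⟩ := S.exists_quad_of_not_apery (h := (P + 1) * x + 0 * y + 0 * z)
    (S.mem 0 (P + 1) 0 0 le_rfl (by omega) le_rfl le_rfl (by ring))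
    (fun h => by have := top _ _ _ (by omega) le_rfl le_rfl h; omega)
  obtain ⟨v₃, h₃⟩ := S.exists_quad_of_not_apery (h := 0 * x + (Q + 1) * y + 0 * z)
    (S.mem 0 0 (Q + 1) 0 le_rfl le_rfl (by omega) le_rfl (by ring))
    (fun h => by have := top _ _ _ le_rfl (by omega) le_rfl h; omega)
  refine S.threeRelated_of (0, 0, 0, c) (0, a, b, 0) (0, P + 1, 0, 0) _ (0, 0, Q + 1, 0) _
    ?_ (Eq.trans ?_ h₂) (Eq.trans ?_ h₃) fun C c₁ c₂ c₃ => ⟨fun j k l h => ?_,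
      fun j k l j' k' l' h e' => ?_⟩
  · rw [quadDeg_mk, quadDeg_mk]; push_cast; linear_combination hr
  · rw [quadDeg_mk]; push_cast; ring
  · rw [quadDeg_mk]; push_cast; ring
  · have hC := shift_addCon C c₁ j k (l % c) (l / c)
    rw [Nat.mod_add_div'] at hC
    have hl := Nat.mod_lt l (by omega : 0 < c)
    have hd : (l : ℤ) = (l % c : ℕ) + (l / c : ℕ) * c := by
      exact_mod_cast (Nat.mod_add_div' l c).symm
    generalize l % c = l₀ at *
    generalize l / c = m at *
    generalize hj' : j + m * a = j' at *
    generalize hk' : k + m * b = k' at *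
    have : P + 1 ≤ j' ∨ Q + 1 ≤ k' := by
      by_contra! hc
      refine h (S.apery_of_le S.apery_top j' k' l₀ P Q r (by omega) (by omega) (by omega)
        (by omega) (by omega) (by omega) ?_ e)
      subst hj' hk'
      push_cast
      linear_combination z * hd + m * hr
    rcases this with h' | h'
    · obtain ⟨d, rfl⟩ := Nat.exists_eq_add_of_le h'
      exact ⟨v₂ + (0, d, k', l₀), C.trans hC
        (by simpa [add_assoc] using C.add c₂ (C.refl (0, d, k', l₀)))⟩
    · obtain ⟨d, rfl⟩ := Nat.exists_eq_add_of_le h'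
      exact ⟨v₃ + (0, j', d, l₀), C.trans hC
        (by simpa [add_assoc] using C.add c₃ (C.refl (0, j', d, l₀)))⟩
  · obtain ⟨m, h1, h2, h3⟩ := S.exists_shift hz (by omega) (by omega) hr hy hx' (by omega)
      (by omega) (by omega) (by omega) (by omega) (by omega) h e'
    exact addCon_of_shift C c₁ h1 h2 h3

lemma exists_lift (S : SymmetricMonoid M t x y z F) {a b c P Q r : ℤ}
    (hz : IsMinRel M t x y z c) (hx : NoRel M t y z x) (hy : NoRel M t x z y) (ha : 0 < a)
    (hb : 0 < b) (hr : c * z = a * x + b * y) (hPa : a ≤ P) (hQb : b ≤ Q) (hr0 : 0 ≤ r)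
    (hrc : r < c) (e : F + t = P * x + Q * y + r * z) :
    ∃ s u : ℤ, 0 ≤ s ∧ 0 ≤ u ∧ (r + 1) * z + (P + 1 - a) * x = (s + 1) * t + u * y := by
  have x0 := S.x_pos
  have c0 := hz.pos
  have e₂ : F + t = (P - a) * x + (Q - b) * y + (r + c) * z := by linear_combination e - hr
  obtain ⟨i, j, k, l, hi, hj, hk, hl, h⟩ :=
    S.exists_of_not_apery (h := (P + 1 - a) * x + 0 * y + (r + 1) * z)
      (S.mem 0 (P + 1 - a) 0 (r + 1) le_rfl (by omega) le_rfl (by omega) (by ring)) (fun h => by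
        obtain ⟨m, hm, h1, h2, h3⟩ := S.exists_le_of_apery hz ha.le hb.le hr hy
          (fun d b l hd hb hl _ hA e => hx d b l hd hA hb hl e) (by omega) (by omega) hr0 hrc e
          (by omega) le_rfl (by omega) h
        have m1 : 1 ≤ m := by
          by_contra! hm1
          obtain rfl : m = 0 := by omega
          omega
        nlinarith)
  rcases hj.eq_or_lt with rfl | hj
  · rcases hl.eq_or_lt with rfl | hl
    · exact ⟨i, k, hi, hk, by linear_combination h⟩
    · exact (S.apery_ne (S.apery_of_le S.apery_top (u := (P + 1 - a) * x + r * z) (P + 1 - a) 0 r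
        P Q r (by omega) le_rfl hr0 (by omega) (by omega) le_rfl (by ring) e) (i + 1) 0 k (l - 1)
        (by omega) le_rfl hk (by omega) (by linear_combination h)).elim
  · exact (S.apery_ne (S.apery_of_le S.apery_top (u := (P - a) * x + (r + 1) * z) (P - a) 0 (r + 1)
        (P - a) (Q - b) (r + c) (by omega) le_rfl (by omega) le_rfl (by omega) (by omega) (by ring)
        e₂) (i + 1) (j - 1) k l (by omega) (by omega) hk hl (by linear_combination h)).elim

lemma hasTwoFactorizations_of_lifts (S : SymmetricMonoid M t x y z F) {a b c P Q r s s' u u' : ℤ}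
    (hz : IsMinRel M t x y z c) (hx : NoRel M t y z x) (hy : NoRel M t x z y) (ha : 0 < a)
    (hb : 0 < b) (hr : c * z = a * x + b * y) (hPa : 2 * a ≤ P) (hQb : 2 * b ≤ Q) (hr0 : 0 ≤ r)
    (hrc : r + 1 < c) (e : F + t = P * x + Q * y + r * z) (hs : 0 ≤ s) (hu : 0 ≤ u)
    (h : (r + 1) * z + (P + 1 - a) * x = (s + 1) * t + u * y) (hu' : 0 ≤ u')
    (h' : (r + 1) * z + (Q + 1 - b) * y = (s' + 1) * t + u' * x) (hss : s ≤ s') :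
    HasTwoFactorizations t x y z F := by
  have x0 := S.x_pos
  have y0 := S.y_pos
  have z0 := S.z_pos
  have c0 := hz.pos
  have hx' : ∀ d b l : ℤ, 0 ≤ d → 0 ≤ b → 0 ≤ l → l < c → Apery M t (d * x) →
      d * x = b * y + l * z → d = 0 := fun d b l hd hb hl _ hA e => hx d b l hd hA hb hl e
  have e₂ : F + t = (P - a) * x + (Q - b) * y + (r + c) * z := by linear_combination e - hr
  have apery_x : ∀ d, 0 ≤ d → d ≤ P → Apery M t (d * x) := fun d hd hdP =>
    S.apery_of_le S.apery_top d 0 0 P Q r hd le_rfl le_rfl hdP (by omega) hr0 (by ring) e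
  have apery_y : ∀ d, 0 ≤ d → d ≤ Q → Apery M t (d * y) := fun d hd hdQ =>
    S.apery_of_le S.apery_top 0 d 0 P Q r le_rfl hd le_rfl (by omega) hdQ hr0 (by ring) e
  have hbu : b ≤ u := by
    by_contra! hbu
    have hA := apery_y (Q + 1 - b + u) (by omega) (by omega)
    rcases hss.eq_or_lt with rfl | hss
    · have := hy _ (P + 1 - a + u') 0 (by omega) hA (by omega) le_rfl
        (by linear_combination h' - h)
      omega
    · exact S.apery_ne hA (s' - s) (P + 1 - a + u') 0 0 (by omega) (by omega) le_rfl le_rfl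
        (by linear_combination h' - h)
  have no_z : ∀ i j k l : ℤ, 0 ≤ i → 0 ≤ j → 0 ≤ k → 0 ≤ l →
      F + z = i * t + j * x + k * y + l * z → l = 0 := by
    intro i j k l hi hj hk hl e'
    by_contra hl'
    exact S.frob_ne i j k (l - 1) hi hj hk (by omega) (by linear_combination e')
  have le_P : ∀ i j k l : ℤ, 0 ≤ i → 0 ≤ j → 0 ≤ k → 0 ≤ l →
      F + z = i * t + j * x + k * y + l * z → j ≤ P := by
    intro i j k l hi hj hk hl e'
    by_contra! hj'
    have := no_z (i + s + 1) (j - (P + 1)) (k + (u - b)) (l + (c - r - 1)) (by omega) (by omega)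
      (by omega) (by omega) (by linear_combination e' + h - hr)
    omega
  have f₁ : F + z = s * t + (a - 1) * x + (Q + u) * y + 0 * z := by linear_combination e + h
  have f₂ : F + z = s' * t + (P + u') * x + (b - 1) * y + 0 * z := by linear_combination e + h'
  obtain rfl : u' = 0 := by
    have := le_P _ _ _ _ (by omega) (by omega) (by omega) le_rfl f₂
    omega
  rcases hss.eq_or_lt with rfl | hss
  · have := hx (P + 1 - a) (Q + 1 - b + u) 0 (by omega) (apery_x _ (by omega) (by omega))
      (by omega) le_rfl (by linear_combination h - h')
    omega
  obtain ⟨σ, τ, hσ, hτ, hστ⟩ : ∃ σ τ : ℤ, 0 < σ ∧ 0 ≤ τ ∧ (Q + 1) * y = σ * t + τ * x := by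
    obtain ⟨i, j, k, l, hi, hj, hk, hl, g⟩ :=
      S.exists_of_not_apery (h := 0 * x + (Q + 1) * y + 0 * z)
        (S.mem 0 0 (Q + 1) 0 le_rfl le_rfl (by omega) le_rfl (by ring)) (fun h => by
          obtain ⟨m, hm, -, h2, -⟩ := S.exists_le_of_apery hz ha.le hb.le hr hy hx' (by omega)
            (by omega) hr0 (by omega) e le_rfl (by omega) le_rfl h
          have := mul_nonneg hm hb.le
          omega)
    obtain rfl := no_z (s + i + 1) (a - 1 + j) (u - 1 + k) l (by omega) (by omega) (by omega) hl
      (by linear_combination f₁ + g)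
    rcases hk.eq_or_lt with rfl | hk
    · exact ⟨i + 1, j, by omega, hj, by linear_combination g⟩
    · exact (S.apery_ne (apery_y Q (by omega) le_rfl) (i + 1) j (k - 1) 0 (by omega) hj (by omega)
        le_rfl (by linear_combination g)).elim
  have E : (P + 1 - a) * x + (s' - s) * t = (u - b) * y + σ * t + τ * x := by
    linear_combination h - h' + hστ
  rcases lt_or_ge σ (s' - s) with hδ | hδ
  · exfalso
    have hτP : P + 1 - a ≤ τ := by
      by_contra! hτP
      exact S.apery_ne (S.apery_of_le S.apery_top (u := (r + 1) * z + τ * x) τ 0 (r + 1) (P - a)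
        (Q - b) (r + c) hτ le_rfl (by omega) (by omega) (by omega) (by omega) (by ring) e₂)
        (s' + 1 - σ) 0 b 0 (by omega) le_rfl hb.le le_rfl (by linear_combination h' - hστ)
    rcases hτP.eq_or_lt with hτP | hτP
    · subst hτP
      have huQ : b + Q + 1 ≤ u := by
        by_contra! huQ
        exact S.apery_ne (apery_y (u - b) (by omega) (by omega)) (s' - s - σ) 0 0 0 (by omega)
          le_rfl le_rfl le_rfl (by linear_combination -E)
      have := le_P (s + 2 * σ) (P + (P + 1 - a)) (u - Q - 2) 0 (by omega) (by omega) (by omega)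
        le_rfl (by linear_combination f₂ + E + hστ)
      omega
    · have := le_P (s + σ) (P + (τ - (P + 1 - a))) (b - 1 + (u - b)) 0 (by omega) (by omega)
        (by omega) le_rfl (by linear_combination f₂ + E)
      omega
  · obtain rfl : σ = s' - s := by
      by_contra hne
      exact S.apery_ne (apery_x (P + 1 - a) (by omega) (by omega)) (σ - (s' - s)) τ (u - b) 0
        (by omega) hτ (by omega) le_rfl (by linear_combination E)
    have E' : (P + 1 - a - τ) * x = (u - b) * y + 0 * z := by linear_combination E
    obtain ⟨n, n'⟩ := nonneg_and_eq_zero_of_comb y0 z0 x0 (by omega) le_rfl E'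
    have τe := hx _ _ _ n (apery_x _ n (by omega)) (by omega) le_rfl E'
    obtain rfl : u = b := by have := n' τe; omega
    obtain rfl : τ = P + 1 - a := by omega
    have small : ∀ i j k l : ℤ, 0 ≤ i → 0 ≤ j → 0 ≤ k → 0 ≤ l →
        F + z = i * t + j * x + k * y + l * z → k ≤ Q →
        i = s' ∧ j = P ∧ k = u - 1 ∧ l = 0 := by
      intro i j k l hi hj hk hl g hkQ
      have hjP := le_P i j k l hi hj hk hl g
      obtain rfl := no_z i j k l hi hj hk hl g
      have A₁ := S.apery_of_le S.apery_top (u := j * x + k * y + 0 * z) j k 0 P Q r hj hk le_rfl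
        hjP hkQ hr0 rfl e
      have A₂ := S.apery_of_le S.apery_top (u := P * x + (u - 1) * y + 0 * z) P (u - 1) 0 P Q r
        (by omega) (by omega) le_rfl le_rfl (by omega) hr0 rfl e
      rcases lt_trichotomy i s' with hi' | rfl | hi'
      · exact (S.apery_ne A₁ (s' - i) P (u - 1) 0 (by omega) (by omega) (by omega) le_rfl
          (by linear_combination f₂ - g)).elim
      · obtain ⟨m, h1, h2, h3⟩ := S.exists_shift (i' := P) (j' := u - 1) hz ha.le hb.le hr hy hx'
          hj hk le_rfl (by omega) (by omega) le_rfl A₁ (by linear_combination f₂ - g)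
        obtain rfl : m = 0 := by
          rcases mul_eq_zero.1 (show m * c = 0 by omega) with h | h <;> omega
        omega
      · exact (S.apery_ne A₂ (i - s') j k 0 (by omega) hj hk le_rfl
          (by linear_combination g - f₂)).elim
    refine hasTwoFactorizations_of (g := z) (by simp) hs (by omega) (by omega) le_rfl
      (by omega : 0 ≤ s') (by omega) (by omega) le_rfl (by omega) f₁ f₂ fun i j k l hi hj hk hl g =>
        ?_
    rcases le_or_gt k Q with hk1 | hk1
    · have := small i j k l hi hj hk hl g hk1
      omega
    · have g' : F + z = (i + (s' - s)) * t + (j + (P + 1 - a)) * x + (k - (Q + 1)) * y + l * z := by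
        linear_combination g + hστ
      rcases le_or_gt (k - (Q + 1)) Q with hk2 | hk2
      · have := small _ _ _ _ (by omega) (by omega) (by omega) hl g' hk2
        omega
      · have := le_P (i + 2 * (s' - s)) (j + 2 * (P + 1 - a)) (k - 2 * (Q + 1)) l (by omega)
          (by omega) (by omega) hl (by linear_combination g' + hστ)
        omega

/-- The case of a single variable with a relation in the Apéry set. -/
lemma hasTwoFactorizations_or_threeRelated_of_isMinRel (S : SymmetricMonoid M t x y z F) {c : ℤ}
    (hz : IsMinRel M t x y z c) (hx : NoRel M t y z x) (hy : NoRel M t x z y) :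
    HasTwoFactorizations t x y z F ∨ ThreeRelated t x y z := by
  have c0 := hz.pos
  obtain ⟨a, b, ha', hb', hr⟩ := hz.rel
  have hb := pos_of_noRel_of_isMinRel hz hx S.z_pos ha' hb' hr
  have ha := pos_of_noRel_of_isMinRel hz.swap hy S.z_pos hb' ha' (hr.trans (add_comm _ _))
  obtain ⟨P, Q, r, hP, hQ, hr0, hrc, e⟩ := S.exists_top hz ha.le hb.le hr
  have hPQ : a ≤ P ∧ b ≤ Q := by
    obtain ⟨m, hm, h1, h2, h3⟩ := S.exists_le_of_apery (i := 0) (j := 0) (l := c) hz ha.le hb.le hr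
      hy (fun d b l hd hb hl _ hA e => hx d b l hd hA hb hl e) hP hQ hr0 hrc e le_rfl le_rfl c0.le
      (by simpa using hz.apery)
    have m1 : 1 ≤ m := by
      by_contra! hm1
      obtain rfl : m = 0 := by omega
      omega
    exact ⟨by nlinarith, by nlinarith⟩
  by_cases h2 : 2 * a ≤ P ∧ 2 * b ≤ Q
  · rcases (show r + 1 ≤ c from hrc).eq_or_lt with hrc1 | hrc1
    · exact .inr (S.threeRelated_of_succ_eq hz hx hy ha.le hb.le hr hP hQ hr0 hrc1 e)
    · left
      obtain ⟨s, u, hs, hu, h⟩ := S.exists_lift hz hx hy ha hb hr hPQ.1 hPQ.2 hr0 hrc e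
      obtain ⟨s', u', hs', hu', h'⟩ := S.swap_xy.exists_lift hz.swap hy hx hb ha
        (hr.trans (add_comm _ _)) hPQ.2 hPQ.1 hr0 hrc (by linear_combination e)
      rcases le_total s s' with hss | hss
      · exact S.hasTwoFactorizations_of_lifts hz hx hy ha hb hr h2.1 h2.2 hr0 hrc1 e hs hu h hu' h'
          hss
      · exact (S.swap_xy.hasTwoFactorizations_of_lifts hz.swap hy hx hb ha
          (hr.trans (add_comm _ _)) h2.2 h2.1 hr0 hrc1 (by linear_combination e) hs' hu' h' hu h
          hss).swap_xy
  · exact .inl (S.hasTwoFactorizations_of_lt hz hx hy ha hb hr hPQ.1 hPQ.2 hr0 hrc e h2)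

lemma threeRelated_of_eq_of_noRel (S : SymmetricMonoid M t x y z F) {a c : ℤ}
    (hz : IsMinRel M t x y z c) (hx : IsMinRel M t y z x a) (hy : NoRel M t x z y)
    (hr : c * z = a * x) : ThreeRelated t x y z := by
  have c0 := hz.pos
  have a0 := hx.pos
  have hr' : c * z = a * x + 0 * y := by linear_combination hr
  have hx' : ∀ d b l : ℤ, 0 ≤ d → 0 ≤ b → 0 ≤ l → l < c → Apery M t (d * x) →
      d * x = b * y + l * z → d = 0 := by
    intro d b l hd hb hl hlc hA e
    rcases lt_or_ge d a with hda | hda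
    · exact hx.eq_zero d b l hd hda hb hl e
    · have e' : b * y = (d - a) * x + (c - l) * z := by linear_combination -hr - e
      have h0 := hy b _ _ hb (S.apery_of_le hA 0 b 0 0 b l le_rfl hb le_rfl le_rfl le_rfl hl
        (by ring) (by linear_combination e)) (by omega) (by omega) e'
      have := (nonneg_and_eq_zero_of_comb S.x_pos S.z_pos S.y_pos (by omega) (by omega) e').2 h0
      omega
  obtain ⟨P, Q, r, hP, hQ, hr0, hrc, e⟩ := S.exists_top hz a0.le le_rfl hr'
  have top : ∀ i j l : ℤ, 0 ≤ i → 0 ≤ j → 0 ≤ l → Apery M t (i * x + j * y + l * z) →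
      ∃ m, 0 ≤ m ∧ i ≤ P - m * a ∧ j ≤ Q - m * 0 ∧ l ≤ r + m * c :=
    fun i j l hi hj hl h => S.exists_le_of_apery hz a0.le le_rfl hr' hy hx' hP hQ hr0 hrc e hi hj
      hl h
  have one_le : ∀ m, 0 ≤ m → 0 < m * c → 1 ≤ m := by
    intro m hm h
    by_contra! hm1
    obtain rfl : m = 0 := by omega
    omega
  have haP : a ≤ P := by
    obtain ⟨m, hm, h1, h2, h3⟩ := top 0 0 c le_rfl le_rfl c0.le (by simpa using hz.apery)
    have := one_le m hm (by omega)
    nlinarith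
  have nA : ¬ Apery M t ((P + 1 - a) * x + 0 * y + (r + 1) * z) := by
    intro h
    obtain ⟨m, hm, h1, h2, h3⟩ := top _ _ _ (by omega) le_rfl (by omega) h
    have := one_le m hm (by omega)
    nlinarith
  obtain ⟨v₃, h₃⟩ := S.exists_quad_of_not_apery (h := (P + 1 - a) * x + 0 * y + (r + 1) * z)
    (S.mem 0 (P + 1 - a) 0 (r + 1) le_rfl (by omega) le_rfl (by omega) (by ring)) nA
  obtain ⟨v₂, h₂⟩ := S.exists_quad_of_not_apery (h := 0 * x + (Q + 1) * y + 0 * z)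
    (S.mem 0 0 (Q + 1) 0 le_rfl le_rfl (by omega) le_rfl (by ring))
    (fun h => by obtain ⟨m, -, -, h2, -⟩ := top _ _ _ le_rfl (by omega) le_rfl h; omega)
  have e₂ : F + t = (P - a) * x + Q * y + (r + c) * z := by linear_combination e - hr
  obtain ⟨B, hB⟩ : ∃ B : ℕ, (B : ℤ) = P + 1 - a := ⟨(P + 1 - a).toNat, by omega⟩
  rw [← hB] at h₃
  lift Q to ℕ using hQ
  lift a to ℕ using a0.le
  lift c to ℕ using c0.le
  lift r to ℕ using hr0
  refine S.threeRelated_of (0, 0, 0, c) (0, a, 0, 0) (0, 0, Q + 1, 0) _ (0, B, 0, r + 1) _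
    ?_ (Eq.trans ?_ h₂) (Eq.trans ?_ h₃) fun C c₁ c₂ c₃ => ⟨fun j k l h => ?_,
      fun j k l j' k' l' h e' => ?_⟩
  · rw [quadDeg_mk, quadDeg_mk]; push_cast; linear_combination hr
  · rw [quadDeg_mk]; push_cast; ring
  · rw [quadDeg_mk]; push_cast; ring
  · have hC := shift_addCon C c₁ j k (l % c) (l / c)
    rw [Nat.mod_add_div', mul_zero, add_zero] at hC
    have hl := Nat.mod_lt l (by omega : 0 < c)
    have hd : (l : ℤ) = (l % c : ℕ) + (l / c : ℕ) * c := by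
      exact_mod_cast (Nat.mod_add_div' l c).symm
    generalize l % c = l₀ at *
    generalize l / c = m at *
    generalize hj' : j + m * a = j' at *
    have hdeg : (j * x + k * y + l * z : ℤ) = j' * x + k * y + l₀ * z := by
      subst hj'
      push_cast
      linear_combination z * hd + m * hr
    rw [hdeg] at h
    have use₃ : ∀ i w : ℕ, C (0, j, k, l) (0, i, k, w) → B ≤ i → r + 1 ≤ w →
        ∃ v, C (0, j, k, l) ((1, 0, 0, 0) + v) := by
      intro i w h hi hw
      obtain ⟨d, rfl⟩ := Nat.exists_eq_add_of_le hi
      obtain ⟨d', rfl⟩ := Nat.exists_eq_add_of_le hw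
      exact ⟨v₃ + (0, d, k, d'), C.trans h
        (by simpa [add_assoc] using C.add c₃ (C.refl (0, d, k, d')))⟩
    by_cases hk : Q + 1 ≤ k
    · obtain ⟨d, rfl⟩ := Nat.exists_eq_add_of_le hk
      exact ⟨v₂ + (0, j', d, l₀), C.trans hC
        (by simpa [add_assoc] using C.add c₂ (C.refl (0, j', d, l₀)))⟩
    · by_cases hl₀ : r + 1 ≤ l₀
      · refine use₃ j' l₀ hC ?_ hl₀
        by_contra hj
        exact h (S.apery_of_le S.apery_top j' k l₀ (P - a) Q (r + c) (by omega) (by omega)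
          (by omega) (by omega) (by omega) (by omega) rfl e₂)
      · have hj : P < j' := by
          by_contra hj
          exact h (S.apery_of_le S.apery_top j' k l₀ P Q r (by omega) (by omega)
            (by omega) (by omega) (by omega) (by omega) rfl e)
        obtain ⟨d, rfl⟩ := Nat.exists_eq_add_of_le (show a ≤ j' by omega)
        exact use₃ d (l₀ + c) (C.trans hC (addCon_of_shift C (m := 1) c₁ (by push_cast; ring)
          (by ring) (by push_cast; ring))) (by omega) (by omega)
  · obtain ⟨m, h1, h2, h3⟩ := S.exists_shift hz (by omega) le_rfl hr' hy hx' (by omega)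
      (by omega) (by omega) (by omega) (by omega) (by omega) h e'
    exact addCon_of_shift C c₁ h1 h2 h3

/-- `u` is a combination of `x, y, z` with natural coefficients. -/
def IsComb (x y z u : ℤ) : Prop :=
  ∃ i j l : ℤ, 0 ≤ i ∧ 0 ≤ j ∧ 0 ≤ l ∧ u = i * x + j * y + l * z

lemma IsComb.add {u v : ℤ} (hu : IsComb x y z u) (hv : IsComb x y z v) :
    IsComb x y z (u + v) := by
  obtain ⟨i, j, l, hi, hj, hl, rfl⟩ := hu
  obtain ⟨i', j', l', hi', hj', hl', rfl⟩ := hv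
  exact ⟨i + i', j + j', l + l', by omega, by omega, by omega, by ring⟩

lemma mem_of_isComb (S : SymmetricMonoid M t x y z F) {u : ℤ} (hu : IsComb x y z u) : u ∈ M := by
  obtain ⟨i, j, l, hi, hj, hl, e⟩ := hu
  exact S.mem 0 i j l le_rfl hi hj hl (by linear_combination e)

lemma eq_zero_of_comb_eq_zero (S : SymmetricMonoid M t x y z F) {a β c i j l : ℤ}
    (hz : IsMinRel M t x y z c) (hx : IsMinRel M t y z x a) (hy : IsMinRel M t x z y β)
    (hr : c * z = a * x) (hi : 0 ≤ i) (hj : -β < j) (hl : -c < l)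
    (e : i * x + j * y + l * z = 0) : i = 0 ∧ j = 0 ∧ l = 0 := by
  have x0 := S.x_pos
  have y0 := S.y_pos
  have z0 := S.z_pos
  rcases le_or_gt 0 j with hj0 | hj0
  · have e' : -l * z = i * x + j * y := by linear_combination -e
    obtain ⟨n, n'⟩ := nonneg_and_eq_zero_of_comb x0 y0 z0 hi hj0 e'
    have h0 := hz.eq_zero _ _ _ n (by omega) hi hj0 e'
    have := n' h0
    omega
  · exfalso
    rcases le_or_gt 0 l with hl0 | hl0
    · have := hy.eq_zero (-j) i l (by omega) (by omega) hi hl0 (by linear_combination -e)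
      omega
    · rcases lt_or_ge i a with hia | hia
      · have e' : i * x = -j * y + -l * z := by linear_combination e
        have h0 := hx.eq_zero i (-j) (-l) hi hia (by omega) (by omega) e'
        have := (nonneg_and_eq_zero_of_comb y0 z0 x0 (by omega) (by omega) e').2 h0
        omega
      · have := hy.eq_zero (-j) (i - a) (c + l) (by omega) (by omega) (by omega) (by omega)
          (by linear_combination -e - hr)
        omega

lemma exists_normal {a α β γ c : ℤ} (hβ : 0 < β) (hc : 0 < c) (ha : 0 ≤ a) (hα : 0 ≤ α)
    (hγ : 0 ≤ γ) (hr : c * z = a * x) (hr' : β * y = α * x + γ * z) (i j l : ℤ) :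
    ∃ i' j' l', 0 ≤ j' ∧ j' < β ∧ 0 ≤ l' ∧ l' < c ∧ (0 ≤ i → 0 ≤ j → 0 ≤ l → 0 ≤ i') ∧
      i * x + j * y + l * z = i' * x + j' * y + l' * z := by
  refine ⟨i + j / β * α + (l + j / β * γ) / c * a, j % β, (l + j / β * γ) % c,
    Int.emod_nonneg _ hβ.ne', Int.emod_lt_of_pos _ hβ, Int.emod_nonneg _ hc.ne',
    Int.emod_lt_of_pos _ hc, fun hi hj hl => ?_, ?_⟩
  · have := Int.ediv_nonneg hj hβ.le
    have := mul_nonneg this hα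
    have := Int.ediv_nonneg (add_nonneg hl (mul_nonneg ‹0 ≤ j / β› hγ)) hc.le
    have := mul_nonneg this ha
    omega
  · have h1 := Int.mul_ediv_add_emod j β
    have h2 := Int.mul_ediv_add_emod (l + j / β * γ) c
    linear_combination -y * h1 - z * h2 + (j / β) * hr' + ((l + j / β * γ) / c) * hr

lemma isComb_or_isComb_sub {a α β γ c : ℤ} (hβ : 0 < β) (hc : 0 < c) (ha : 0 ≤ a) (hα : 0 ≤ α)
    (hγ : 0 ≤ γ) (hr : c * z = a * x) (hr' : β * y = α * x + γ * z) (i j l : ℤ) :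
    IsComb x y z (i * x + j * y + l * z) ∨
      IsComb x y z (β * y + c * z - x - y - z - (i * x + j * y + l * z)) := by
  obtain ⟨i', j', l', h1, h2, h3, h4, -, e⟩ := exists_normal hβ hc ha hα hγ hr hr' i j l
  rw [e]
  rcases le_or_gt 0 i' with hi | hi
  · exact .inl ⟨i', j', l', hi, h1, h3, rfl⟩
  · exact .inr ⟨-1 - i', β - 1 - j', c - 1 - l', by omega, by omega, by omega, by ring⟩

lemma not_isComb_frob (S : SymmetricMonoid M t x y z F) {a α β γ c : ℤ}
    (hz : IsMinRel M t x y z c) (hx : IsMinRel M t y z x a) (hy : IsMinRel M t x z y β)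
    (hr : c * z = a * x) (hα : 0 ≤ α) (hγ : 0 ≤ γ) (hr' : β * y = α * x + γ * z) :
    ¬ IsComb x y z (β * y + c * z - x - y - z) := by
  rintro ⟨i, j, l, hi, hj, hl, e⟩
  obtain ⟨i', j', l', h1, h2, h3, h4, h5, e'⟩ :=
    exists_normal hy.pos hz.pos hx.pos.le hα hγ hr hr' i j l
  have := S.eq_zero_of_comb_eq_zero hz hx hy hr (i := i' + 1) (j := j' - (β - 1))
    (l := l' - (c - 1)) (by have := h5 hi hj hl; omega) (by omega) (by omega)
    (by linear_combination -e - e')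
  have := h5 hi hj hl
  omega

lemma addCon_of_eq (S : SymmetricMonoid M t x y z F) {a α β γ c : ℕ}
    (hz : IsMinRel M t x y z c) (hx : IsMinRel M t y z x a) (hy : IsMinRel M t x z y β)
    (hr : (c * z : ℤ) = a * x) (hr' : (β * y : ℤ) = α * x + γ * z) (C : AddCon (ℕ × ℕ × ℕ × ℕ))
    (h₁ : C (0, 0, 0, c) (0, a, 0, 0)) (h₂ : C (0, 0, β, 0) (0, α, 0, γ)) {j k l j' k' l' : ℕ}
    (e : (j * x + k * y + l * z : ℤ) = j' * x + k' * y + l' * z) :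
    C (0, j, k, l) (0, j', k', l') := by
  have c0 := hz.pos
  have β0 := hy.pos
  have normal : ∀ j k l : ℕ, ∃ j' k' l' : ℕ, k' < β ∧ l' < c ∧ C (0, j, k, l) (0, j', k', l') ∧
      (j * x + k * y + l * z : ℤ) = j' * x + k' * y + l' * z := by
    intro j k l
    have H₂ : C (0, j, k, l) (0, j + k / β * α, k % β, l + k / β * γ) := by
      have := C.add (C.refl (0, j, k % β, l)) (C.nsmul (k / β) h₂)
      simpa [Nat.mod_add_div'] using this
    have H₁ := shift_addCon C h₁ (j + k / β * α) (k % β) ((l + k / β * γ) % c)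
      ((l + k / β * γ) / c)
    rw [Nat.mod_add_div', mul_zero, add_zero] at H₁
    refine ⟨_, _, _, Nat.mod_lt _ (by omega), Nat.mod_lt _ (by omega), C.trans H₂ H₁, ?_⟩
    have d₁ : (k : ℤ) = (k % β : ℕ) + (k / β : ℕ) * β := by
      exact_mod_cast (Nat.mod_add_div' k β).symm
    have d₂ : (l + (k / β : ℕ) * γ : ℤ) =
        ((l + k / β * γ) % c : ℕ) + ((l + k / β * γ) / c : ℕ) * c := by
      exact_mod_cast (Nat.mod_add_div' (l + k / β * γ) c).symm
    generalize (l + k / β * γ) % c = l' at *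
    generalize (l + k / β * γ) / c = m at *
    generalize k % β = k' at *
    generalize k / β = n at *
    push_cast
    linear_combination y * d₁ + z * d₂ + n * hr' + m * hr
  obtain ⟨j₁, k₁, l₁, hk₁, hl₁, H₁, e₁⟩ := normal j k l
  obtain ⟨j₂, k₂, l₂, hk₂, hl₂, H₂, e₂⟩ := normal j' k' l'
  have h : j₁ = j₂ ∧ k₁ = k₂ ∧ l₁ = l₂ := by
    rcases le_total j₁ j₂ with h | h
    · have := S.eq_zero_of_comb_eq_zero hz hx hy hr (i := j₂ - j₁) (j := k₂ - k₁) (l := l₂ - l₁)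
        (by omega) (by omega) (by omega) (by linear_combination -e₂ - e + e₁)
      omega
    · have := S.eq_zero_of_comb_eq_zero hz hx hy hr (i := j₁ - j₂) (j := k₁ - k₂) (l := l₁ - l₂)
        (by omega) (by omega) (by omega) (by linear_combination e₂ + e - e₁)
      omega
  obtain ⟨rfl, rfl, rfl⟩ := h
  exact C.trans H₁ (C.symm H₂)

/-- If `F + t` exceeds the Frobenius number `f` of `⟨x, y, z⟩` by `i * x + j * y + l * z` in
normal form, then `i` is nonnegative. -/
lemma nonneg_of_frob_add_eq (S : SymmetricMonoid M t x y z F) {a α β γ c i j l : ℤ}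
    (hz : IsMinRel M t x y z c) (hx : IsMinRel M t y z x a) (hy : IsMinRel M t x z y β)
    (hr : c * z = a * x) (hα : 0 ≤ α) (hγ : 0 ≤ γ) (hr' : β * y = α * x + γ * z)
    (hj0 : 0 ≤ j) (hjβ : j < β) (hl0 : 0 ≤ l) (hlc : l < c)
    (e : F + t = β * y + c * z - x - y - z + (i * x + j * y + l * z))
    (apery : ∀ v, IsComb x y z v → (Apery M t v ↔ ¬ IsComb x y z (v - (i * x + j * y + l * z)))) :
    0 ≤ i := by
  have x0 := S.x_pos
  have y0 := S.y_pos
  have z0 := S.z_pos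
  have a0 := hx.pos
  have β0 := hy.pos
  have c0 := hz.pos
  by_contra! hi
  have nz := (apery _ ⟨0, 0, c, le_rfl, le_rfl, c0.le, by ring⟩).1 hz.apery
  have ny := (apery _ ⟨0, β, 0, le_rfl, β0.le, le_rfl, by ring⟩).1 hy.apery
  have hj : 0 < j := by
    by_contra!
    exact nz ⟨-i, -j, c - l, by omega, by omega, by omega, by ring⟩
  have hl : 0 < l := by
    by_contra!
    exact ny ⟨-i, β - j, -l, by omega, by omega, by omega, by ring⟩
  have hia : -i < a := by
    by_contra!
    exact ny ⟨-i - a, β - j, c - l, by omega, by omega, by omega, by linear_combination -hr⟩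
  have nx : ∀ u v w : ℤ, 0 ≤ u → 0 ≤ v → 0 ≤ w → -i * x = u * x + v * y + w * z →
      v = 0 ∧ w = 0 := by
    intro u v w hu hv hw h
    have h' : (-i - u) * x = v * y + w * z := by linear_combination h
    obtain ⟨n, n'⟩ := nonneg_and_eq_zero_of_comb y0 z0 x0 hv hw h'
    exact n' (hx.eq_zero _ _ _ n (by omega) hv hw h')
  have nz' : ∀ u v w : ℤ, 0 ≤ u → 0 ≤ v → 0 ≤ w → (c - l) * z = u * x + v * y + w * z →
      u = 0 ∧ v = 0 := by
    intro u v w hu hv hw h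
    have h' : (c - l - w) * z = u * x + v * y := by linear_combination h
    obtain ⟨n, n'⟩ := nonneg_and_eq_zero_of_comb x0 y0 z0 hu hv h'
    exact n' (hz.eq_zero _ _ _ n (by omega) hu hv h')
  obtain ⟨s, p, hs, hp, h₁⟩ : ∃ s p : ℤ, 0 ≤ s ∧ 0 ≤ p ∧ j * y + l * z = (s + 1) * t + p * x := by
    have hc : IsComb x y z (j * y + l * z) := ⟨0, j, l, le_rfl, hj0, hl0, by ring⟩
    obtain ⟨s, p, k, m, hs, hp, hk, hm, h⟩ := S.exists_of_not_apery (S.mem_of_isComb hc)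
      (fun h => (apery _ hc).1 h ⟨-i, 0, 0, by omega, le_rfl, le_rfl, by ring⟩)
    rcases hk.eq_or_lt with rfl | hk
    · rcases hm.eq_or_lt with rfl | hm
      · exact ⟨s, p, hs, hp, by linear_combination h⟩
      · refine (S.apery_ne (h := j * y + (l - 1) * z) ?_ (s + 1) p 0 (m - 1) (by omega) hp le_rfl
          (by omega) (by linear_combination h)).elim
        refine (apery _ ⟨0, j, l - 1, le_rfl, hj0, by omega, by ring⟩).2 ?_
        rintro ⟨u, v, w, hu, hv, hw, g⟩
        have := nx u v (w + 1) hu hv (by omega) (by linear_combination g)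
        omega
    · refine (S.apery_ne (h := (j - 1) * y + l * z) ?_ (s + 1) p (k - 1) m (by omega) hp (by omega)
        hm (by linear_combination h)).elim
      refine (apery _ ⟨0, j - 1, l, le_rfl, by omega, hl0, by ring⟩).2 ?_
      rintro ⟨u, v, w, hu, hv, hw, g⟩
      have := nx u (v + 1) w hu (by omega) hw (by linear_combination g)
      omega
  obtain ⟨s', p', hs', hp', h₂⟩ : ∃ s p : ℤ, 0 ≤ s ∧ 0 ≤ p ∧
      (a + i) * x + j * y = (s + 1) * t + p * z := by
    have hc : IsComb x y z ((a + i) * x + j * y) := ⟨a + i, j, 0, by omega, hj0, le_rfl, by ring⟩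
    obtain ⟨s, k, m, p, hs, hk, hm, hp, h⟩ := S.exists_of_not_apery (S.mem_of_isComb hc)
      (fun h => (apery _ hc).1 h ⟨0, 0, c - l, le_rfl, le_rfl, by omega, by linear_combination -hr⟩)
    rcases hk.eq_or_lt with rfl | hk
    · rcases hm.eq_or_lt with rfl | hm
      · exact ⟨s, p, hs, hp, by linear_combination h⟩
      · refine (S.apery_ne (h := (a + i) * x + (j - 1) * y) ?_ (s + 1) 0 (m - 1) p (by omega) le_rfl
          (by omega) hp (by linear_combination h)).elim
        refine (apery _ ⟨a + i, j - 1, 0, by omega, by omega, le_rfl, by ring⟩).2 ?_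
        rintro ⟨u, v, w, hu, hv, hw, g⟩
        have := nz' u (v + 1) w hu (by omega) hw (by linear_combination g + hr)
        omega
    · refine (S.apery_ne (h := (a + i - 1) * x + j * y) ?_ (s + 1) (k - 1) m p (by omega) (by omega)
        hm hp (by linear_combination h)).elim
      refine (apery _ ⟨a + i - 1, j, 0, by omega, hj0, le_rfl, by ring⟩).2 ?_
      rintro ⟨u, v, w, hu, hv, hw, g⟩
      have := nz' (u + 1) v w (by omega) hv hw (by linear_combination g + hr)
      omega
  have hp'c : p' + l ≤ c := by
    by_contra! h
    exact S.frob_ne s' (a - 1) (β - 1) (p' + l - 1 - c) hs' (by omega) (by omega) (by omega)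
      (by linear_combination e + h₂ + 2 * hr)
  have hpi : p ≤ -i := by
    by_contra! h
    exact S.frob_ne s (p + i - 1) (β - 1) (c - 1) hs (by omega) (by omega) (by omega)
      (by linear_combination e + h₁)
  have E : (s + 1) * t + (p + (a + i)) * x = (s' + 1) * t + (p' + l) * z := by
    linear_combination h₂ - h₁
  obtain rfl : s = s' := by
    rcases lt_trichotomy s s' with h | h | h
    · exact (S.apery_ne (S.apery_of_le hx.apery (u := (p + (a + i)) * x) (p + (a + i)) 0 0 a 0 0
        (by omega) le_rfl le_rfl (by omega) le_rfl le_rfl (by ring) (by ring)) (s' - s) 0 0 (p' + l)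
        (by omega) le_rfl le_rfl (by omega) (by linear_combination E)).elim
    · exact h
    · exact (S.apery_ne (S.apery_of_le hz.apery (u := (p' + l) * z) 0 0 (p' + l) 0 0 c
        le_rfl le_rfl (by omega) le_rfl le_rfl (by omega) (by ring) (by ring)) (s - s')
        (p + (a + i)) 0 0 (by omega) (by omega) le_rfl le_rfl (by linear_combination -E)).elim
  have hpc : p' + l = c := by
    by_contra h
    have := hz.eq_zero (p' + l) (p + (a + i)) 0 (by omega) (by omega) (by omega) le_rfl
      (by linear_combination -E)
    omega
  have hpi' : (p + i) * x = 0 := by linear_combination E + z * hpc + hr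
  have ev : i * x + j * y + l * z = (s + 1) * t := by linear_combination h₁ + hpi'
  rcases isComb_or_isComb_sub β0 c0 a0.le hα hγ hr hr' i j l with h | h
  · refine absurd h ?_
    rintro ⟨u, v, w, hu, hv, hw, g⟩
    obtain ⟨u', v', w', h1, h2, h3, h4, h5, e'⟩ :=
      exists_normal β0 c0 a0.le hα hγ hr hr' u v w
    have := h5 hu hv hw
    have := S.eq_zero_of_comb_eq_zero hz hx hy hr (i := u' - i) (j := v' - j) (l := w' - l)
      (by omega) (by omega) (by omega) (by linear_combination -g - e')
    omega
  · obtain ⟨u, v, w, hu, hv, hw, g⟩ := h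
    exact S.frob_ne (s + s + 1) u v w (by omega) hu hv hw (by linear_combination e + g + 2 * ev)

lemma threeRelated_of_eq_of_isMinRel (S : SymmetricMonoid M t x y z F) {a β c : ℤ}
    (hz : IsMinRel M t x y z c) (hx : IsMinRel M t y z x a) (hy : IsMinRel M t x z y β)
    (hr : c * z = a * x) : ThreeRelated t x y z := by
  have a0 := hx.pos
  have β0 := hy.pos
  have c0 := hz.pos
  obtain ⟨α, γ, hα, hγ, hr'⟩ := hy.rel
  obtain ⟨P, Q, R, hP, hQ, hR, e⟩ := S.exists_of_apery S.apery_top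
  obtain ⟨i, j, l, hj, hjβ, hl, hlc, -, e'⟩ :=
    exists_normal β0 c0 a0.le hα hγ hr hr' (P + 1) (Q - β + 1) (R - c + 1)
  have ew : F + t = β * y + c * z - x - y - z + (i * x + j * y + l * z) := by
    linear_combination e + e'
  have apery : ∀ v, IsComb x y z v →
      (Apery M t v ↔ ¬ IsComb x y z (v - (i * x + j * y + l * z))) := by
    intro v hv
    constructor
    · intro hA h
      refine S.not_isComb_frob hz hx hy hr hα hγ hr' ?_
      convert IsComb.add h (S.exists_of_apery (S.apery_dual hA)) using 1
      linear_combination -ew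
    · intro h
      by_contra hA
      refine hA (Apery.of_add (v := F + t - v) (by rw [add_sub_cancel]; exact S.apery_top)
        (S.mem_of_isComb hv) (S.mem_of_isComb ?_))
      obtain ⟨u, v, w, -, -, -, rfl⟩ := hv
      rcases isComb_or_isComb_sub β0 c0 a0.le hα hγ hr hr' (P - u) (Q - v) (R - w) with g | g
      · convert g using 1
        linear_combination e
      · refine absurd ?_ h
        convert g using 1
        linear_combination ew - e
  have hi := S.nonneg_of_frob_add_eq hz hx hy hr hα hγ hr' hj hjβ hl hlc ew apery
  obtain ⟨v₃, h₃⟩ := S.exists_quad_of_not_apery (h := i * x + j * y + l * z)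
    (S.mem 0 i j l le_rfl hi hj hl (by ring))
    (fun h => (apery _ ⟨i, j, l, hi, hj, hl, rfl⟩).1 h
      ⟨0, 0, 0, le_rfl, le_rfl, le_rfl, by ring⟩)
  lift a to ℕ using a0.le
  lift β to ℕ using β0.le
  lift c to ℕ using c0.le
  lift α to ℕ using hα
  lift γ to ℕ using hγ
  lift i to ℕ using hi
  lift j to ℕ using hj
  lift l to ℕ using hl
  refine S.threeRelated_of (0, 0, 0, c) (0, a, 0, 0) (0, 0, β, 0) (0, α, 0, γ) (0, i, j, l) _
    ?_ ?_ (Eq.trans ?_ h₃) fun C c₁ c₂ c₃ => ⟨fun u v w h => ?_,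
      fun u v w u' v' w' h e' => S.addCon_of_eq hz hx hy hr hr' C c₁ c₂ e'⟩
  · rw [quadDeg_mk, quadDeg_mk]; push_cast; linear_combination hr
  · rw [quadDeg_mk, quadDeg_mk]; push_cast; linear_combination hr'
  · rw [quadDeg_mk]; push_cast; ring
  · rw [apery _ ⟨u, v, w, by omega, by omega, by omega, rfl⟩, not_not] at h
    obtain ⟨p, q, r, hp, hq, hr0, g⟩ := h
    lift p to ℕ using hp
    lift q to ℕ using hq
    lift r to ℕ using hr0
    refine ⟨v₃ + (0, p, q, r), C.trans (S.addCon_of_eq hz hx hy hr hr' C c₁ c₂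
      (j' := i + p) (k' := j + q) (l' := l + r) (by push_cast; linear_combination g)) ?_⟩
    simpa [add_assoc] using C.add c₃ (C.refl (0, p, q, r))

/-- If minimal relations for `x` and `z` have the same degree, three relations suffice. -/
lemma threeRelated_of_eq (S : SymmetricMonoid M t x y z F) {a c : ℤ}
    (hz : IsMinRel M t x y z c) (hx : IsMinRel M t y z x a) (hr : c * z = a * x) :
    ThreeRelated t x y z := by
  rcases S.swap_yz.noRel_or_exists_isMinRel with hy | ⟨β, hy⟩
  · exact S.threeRelated_of_eq_of_noRel hz hx hy hr
  · exact S.threeRelated_of_eq_of_isMinRel hz hx hy hr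

lemma threeRelated_of_forall_eq_zero (S : SymmetricMonoid M t x y z F) {c : ℤ}
    (hz : IsMinRel M t x y z c)
    (h : ∀ a b : ℤ, 0 ≤ a → 0 ≤ b → c * z = a * x + b * y → b = 0) : ThreeRelated t x y z := by
  have c0 := hz.pos
  obtain ⟨a, b, ha, hb, hr⟩ := hz.rel
  obtain rfl := h a b ha hb hr
  have hA := hz.apery
  rw [hr, zero_mul, add_zero] at hA
  rcases S.swap_yz.swap_xy.swap_yz.noRel_or_exists_isMinRel with hx | ⟨A, hx⟩
  · have := hx a c 0 ha hA c0.le le_rfl (by linear_combination -hr)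
    subst this
    have := mul_pos c0 S.z_pos
    linarith
  · replace hx := hx.swap
    have A0 := hx.pos
    have hAa : A ≤ a := by
      by_contra! hlt
      have := hx.eq_zero a 0 c ha hlt le_rfl c0.le (by linear_combination -hr)
      subst this
      have := mul_pos c0 S.z_pos
      linarith
    rcases hAa.eq_or_lt with rfl | hAa
    · exact S.threeRelated_of_eq hz hx (by linear_combination hr)
    · obtain ⟨b', c', hb', hc', hr'⟩ := hx.rel
      rcases hc'.eq_or_lt with rfl | hc'
      · obtain rfl := h (a - A) b' (by omega) hb' (by linear_combination hr + hr')
        have := mul_pos A0 S.x_pos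
        linarith
      · exfalso
        rcases lt_or_ge c' c with hcc | hcc
        · have := hz.eq_zero (c - c') (a - A) b' (by omega) (by omega) (by omega) hb'
            (by linear_combination hr + hr')
          omega
        · have h1 := mul_nonneg (sub_nonneg.2 hcc) S.z_pos.le
          have h2 := mul_pos (sub_pos.2 hAa) S.x_pos
          have h3 := mul_nonneg hb' S.y_pos.le
          linarith

/-- If two of the variables have a relation in the Apéry set, three relations suffice. -/
lemma threeRelated_of_isMinRel (S : SymmetricMonoid M t x y z F) {β c : ℤ}
    (hz : IsMinRel M t x y z c) (hy : IsMinRel M t x z y β) : ThreeRelated t x y z := by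
  by_cases h : c * z = β * y
  · exact (S.swap_xy.threeRelated_of_eq hz.swap hy h).swap_xy
  · by_cases h₁ : ∀ a b : ℤ, 0 ≤ a → 0 ≤ b → c * z = a * x + b * y → b = 0
    · exact S.threeRelated_of_forall_eq_zero hz h₁
    · refine (S.swap_yz.threeRelated_of_forall_eq_zero hy fun α γ hα hγ hr' => ?_).swap_yz
      push Not at h₁
      obtain ⟨a, b, ha, hb, hr, hb0⟩ := h₁
      by_contra hγ0
      exact h (S.mul_eq_mul_of_isMinRel hz hy ha (by omega) hr hα (by omega) hr')

theorem hasTwoFactorizations_or_threeRelated (S : SymmetricMonoid M t x y z F) :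
    HasTwoFactorizations t x y z F ∨ ThreeRelated t x y z := by
  rcases S.noRel_or_exists_isMinRel with hz | ⟨c, hz⟩ <;>
    rcases S.swap_yz.noRel_or_exists_isMinRel with hy | ⟨b, hy⟩ <;>
    rcases S.swap_xy.swap_yz.noRel_or_exists_isMinRel with hx | ⟨a, hx⟩
  · exact .inr (S.threeRelated_of_noRel hx hy hz)
  · exact (S.swap_xy.swap_yz.hasTwoFactorizations_or_threeRelated_of_isMinRel hx hy.swap
      hz.swap).imp (fun h => h.swap_yz.swap_xy) fun h => h.swap_yz.swap_xy
  · exact (S.swap_yz.hasTwoFactorizations_or_threeRelated_of_isMinRel hy hx.swap hz).imp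
      (fun h => h.swap_yz) fun h => h.swap_yz
  · exact .inr (S.swap_yz.swap_xy.threeRelated_of_isMinRel hy.swap hx.swap).swap_xy.swap_yz
  · exact (S.hasTwoFactorizations_or_threeRelated_of_isMinRel hz hx hy)
  · exact .inr (S.swap_xy.threeRelated_of_isMinRel hz.swap hx).swap_xy
  · exact .inr (S.threeRelated_of_isMinRel hz hy)
  · exact .inr (S.threeRelated_of_isMinRel hz hy)

end SymmetricMonoid

section Ideal

open MvPolynomial

variable (k : Type*) [Field k]

/-- The monomial with exponent vector `u`. -/
noncomputable def quadMonomial (u : ℕ × ℕ × ℕ × ℕ) : MvPolynomial (Fin 4) k :=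
  X 0 ^ u.1 * X 1 ^ u.2.1 * X 2 ^ u.2.2.1 * X 3 ^ u.2.2.2

lemma quadMonomial_add (u v : ℕ × ℕ × ℕ × ℕ) :
    quadMonomial k (u + v) = quadMonomial k u * quadMonomial k v := by
  simp only [quadMonomial, Prod.fst_add, Prod.snd_add, pow_add]
  ring

lemma monomial_eq_smul_quadMonomial (d : Fin 4 →₀ ℕ) (c : k) :
    monomial d c = c • quadMonomial k (d 0, d 1, d 2, d 3) := by
  rw [monomial_eq, Finsupp.prod_fintype _ _ (fun i => pow_zero _), Fin.prod_univ_four,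
    quadMonomial, C_mul']

lemma aeval_quadMonomial (n : Fin 4 → ℕ) (u : ℕ × ℕ × ℕ × ℕ) :
    aeval (fun i => (Polynomial.X : Polynomial k) ^ n i) (quadMonomial k u) =
      Polynomial.X ^ (u.1 * n 0 + u.2.1 * n 1 + u.2.2.1 * n 2 + u.2.2.2 * n 3) := by
  simp only [quadMonomial, map_mul, map_pow, aeval_X, ← pow_mul, ← pow_add]
  congr 1
  ring

/-- Generators of the congruence of equality of degrees give generators of the toric ideal. -/
lemma ThreeRelated.exists_span_eq_ker {n : Fin 4 → ℕ}
    (h : ThreeRelated (n 0) (n 1) (n 2) (n 3)) :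
    ∃ g : Fin 3 → MvPolynomial (Fin 4) k,
      Ideal.span (Set.range g) = RingHom.ker (aeval
        (fun i => (Polynomial.X : Polynomial k) ^ n i) :
        MvPolynomial (Fin 4) k →ₐ[k] Polynomial k) := by
  classical
  obtain ⟨p₁, q₁, p₂, q₂, p₃, q₃, h₁, h₂, h₃, H⟩ := h
  set φ : MvPolynomial (Fin 4) k →ₐ[k] Polynomial k :=
    aeval (fun i => (Polynomial.X : Polynomial k) ^ n i) with hφ
  have map_eq : ∀ u v, quadDeg (n 0) (n 1) (n 2) (n 3) u = quadDeg (n 0) (n 1) (n 2) (n 3) v →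
      φ (quadMonomial k u) = φ (quadMonomial k v) := by
    intro u v huv
    rw [hφ, aeval_quadMonomial, aeval_quadMonomial]
    congr 1
    unfold quadDeg at huv
    exact_mod_cast huv
  set g : Fin 3 → MvPolynomial (Fin 4) k := ![quadMonomial k p₁ - quadMonomial k q₁,
    quadMonomial k p₂ - quadMonomial k q₂, quadMonomial k p₃ - quadMonomial k q₃] with hg
  refine ⟨g, le_antisymm ?_ ?_⟩
  · rw [Ideal.span_le]
    rintro _ ⟨i, rfl⟩
    rw [SetLike.mem_coe, RingHom.mem_ker]
    fin_cases i
    · exact (map_sub φ _ _).trans (sub_eq_zero.2 (map_eq _ _ h₁))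
    · exact (map_sub φ _ _).trans (sub_eq_zero.2 (map_eq _ _ h₂))
    · exact (map_sub φ _ _).trans (sub_eq_zero.2 (map_eq _ _ h₃))
  · set J := Ideal.span (Set.range g)
    let m : ℕ × ℕ × ℕ × ℕ → MvPolynomial (Fin 4) k ⧸ J := fun u =>
      Ideal.Quotient.mkₐ k J (quadMonomial k u)
    have m_add : ∀ u v, m (u + v) = m u * m v := fun u v => by
      simp only [m, quadMonomial_add, map_mul]
    let D : AddCon (ℕ × ℕ × ℕ × ℕ) :=
      { r := fun u v => m u = m v
        iseqv := ⟨fun _ => rfl, fun h => h.symm, fun h h' => h.trans h'⟩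
        add' := fun {a b c d} h h' => by
          rw [m_add, m_add, show m a = m b from h, show m c = m d from h'] }
    have gen : ∀ i, g i ∈ J := fun i => Ideal.subset_span ⟨i, rfl⟩
    have hD : ∀ u v, quadDeg (n 0) (n 1) (n 2) (n 3) u = quadDeg (n 0) (n 1) (n 2) (n 3) v →
        m u = m v :=
      H D (Ideal.Quotient.eq.2 (gen 0)) (Ideal.Quotient.eq.2 (gen 1)) (Ideal.Quotient.eq.2 (gen 2))
    let deg : ℕ × ℕ × ℕ × ℕ → ℕ := fun u =>
      u.1 * n 0 + u.2.1 * n 1 + u.2.2.1 * n 2 + u.2.2.2 * n 3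
    let σ : Polynomial k →ₗ[k] MvPolynomial (Fin 4) k ⧸ J :=
      Polynomial.lsum fun d => LinearMap.toSpanSingleton k _ (m (Function.invFun deg d))
    have hσ : ∀ d, σ (Polynomial.X ^ d) = m (Function.invFun deg d) := fun d => by
      simp only [σ, Polynomial.lsum_apply]
      rw [Polynomial.X_pow_eq_monomial, Polynomial.sum_monomial_index] <;> simp
    have comp : σ.comp φ.toLinearMap = (Ideal.Quotient.mkₐ k J).toLinearMap := by
      refine (basisMonomials (Fin 4) k).ext fun d => ?_
      simp only [coe_basisMonomials]
      rw [monomial_eq_smul_quadMonomial, one_smul, LinearMap.comp_apply,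
        AlgHom.toLinearMap_apply, AlgHom.toLinearMap_apply, hφ, aeval_quadMonomial, hσ]
      refine hD _ _ ?_
      have := Function.invFun_eq (f := deg) ⟨(d 0, d 1, d 2, d 3), rfl⟩
      simp only [deg] at this
      unfold quadDeg
      exact_mod_cast this
    intro p hp
    have hp0 : φ p = 0 := hp
    have := LinearMap.congr_fun comp p
    rw [LinearMap.comp_apply, AlgHom.toLinearMap_apply, hp0, map_zero] at this
    exact Ideal.Quotient.eq_zero_iff_mem.1 this.symm

end Ideal

lemma HasTwoFactorizations.exists_ncard_eq_two {n : Fin 4 → ℕ} {F : ℕ}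
    (h : HasTwoFactorizations (n 0) (n 1) (n 2) (n 3) F) :
    ∃ i : Fin 4, {a : Fin 4 → ℕ | ∑ j, a j * n j = F + n i}.ncard = 2 := by
  obtain ⟨g, hg, ⟨p0, p1, p2, p3⟩, ⟨q0, q1, q2, q3⟩, hpq, H⟩ := h
  obtain ⟨i, rfl⟩ : ∃ i, g = n i := by
    rcases hg with rfl | rfl | rfl | rfl
    exacts [⟨0, rfl⟩, ⟨1, rfl⟩, ⟨2, rfl⟩, ⟨3, rfl⟩]
  refine ⟨i, ?_⟩
  have hne : ![p0, p1, p2, p3] ≠ ![q0, q1, q2, q3] := by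
    intro h
    refine hpq ?_
    simp only [Prod.mk.injEq]
    exact ⟨congr_fun h 0, congr_fun h 1, congr_fun h 2, congr_fun h 3⟩
  rw [← Set.ncard_pair hne]
  congr 1
  ext a
  have ext_iff : ∀ b : Fin 4 → ℕ,
      a = b ↔ (a 0, a 1, a 2, a 3) = (b 0, b 1, b 2, b 3) := fun b => by
    simp [funext_iff, Fin.forall_fin_succ]
  have := H (a 0, a 1, a 2, a 3)
  rw [quadDeg_mk] at this
  rw [Set.mem_ofPred_eq, Set.mem_insert_iff, Set.mem_singleton_iff, ext_iff, ext_iff,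
    Fin.sum_univ_four]
  exact Iff.trans (by exact_mod_cast Iff.rfl) this

lemma pos_of_ne {n : Fin 4 → ℕ} {H : Set ℕ} (hgen : H = {m | ∃ a : Fin 4 → ℕ, m = ∑ i, a i * n i})
    {j : Fin 4} (hmin : {m | ∃ a : Fin 4 → ℕ, a j = 0 ∧ m = ∑ i, a i * n i} ≠ H) : 0 < n j := by
  by_contra! h0
  refine hmin ?_
  rw [hgen]
  ext m
  constructor
  · rintro ⟨a, -, e⟩
    exact ⟨a, e⟩
  · rintro ⟨a, rfl⟩
    refine ⟨Function.update a j 0, by simp, Finset.sum_congr rfl fun i _ => ?_⟩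
    rcases eq_or_ne i j with rfl | hij
    · simp [Nat.le_zero.1 h0]
    · simp [hij]

lemma compl_nonempty_of_ne {n : Fin 4 → ℕ} {H : Set ℕ}
    (hgen : H = {m | ∃ a : Fin 4 → ℕ, m = ∑ i, a i * n i})
    (hmin : ∀ j : Fin 4, {m | ∃ a : Fin 4 → ℕ, a j = 0 ∧ m = ∑ i, a i * n i} ≠ H) :
    Hᶜ.Nonempty := by
  by_contra hne
  rw [Set.not_nonempty_iff_eq_empty, Set.compl_empty_iff] at hne
  have h1 : 1 ∈ H := hne ▸ Set.mem_univ 1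
  rw [hgen] at h1
  obtain ⟨a, e⟩ := h1
  obtain ⟨i, hi⟩ : ∃ i, n i = 1 := by
    obtain ⟨i, -, hi⟩ := Finset.exists_ne_zero_of_sum_ne_zero (e ▸ one_ne_zero)
    have : a i * n i ≤ 1 := e ▸
      Finset.single_le_sum (f := fun i => a i * n i) (fun _ _ => Nat.zero_le _) (Finset.mem_univ i)
    exact ⟨i, Nat.eq_one_of_mul_eq_one_left (m := a i) (by omega)⟩
  obtain ⟨j, hj⟩ := exists_ne i
  refine hmin j (Set.eq_univ_of_forall (fun m => ?_) |>.trans hne.symm)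
  exact ⟨Pi.single i m, by simp [hj], by simp [Pi.single_apply, hi]⟩

/-- The symmetric monoid attached to a symmetric numerical semigroup with four generators. -/
lemma exists_symmetricMonoid {n : Fin 4 → ℕ} {H : Set ℕ} (hH : IsNumericalSemigroup H)
    (hsym : (PF H).ncard = 1) (hgen : H = {m | ∃ a : Fin 4 → ℕ, m = ∑ i, a i * n i})
    (hmin : ∀ j : Fin 4, {m | ∃ a : Fin 4 → ℕ, a j = 0 ∧ m = ∑ i, a i * n i} ≠ H) :
    ∃ M : AddSubmonoid ℤ, SymmetricMonoid M (n 0) (n 1) (n 2) (n 3) (Frob H) := by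
  obtain ⟨h0, hadd, hfin⟩ := hH
  have pos : ∀ j, (0 : ℤ) < n j := fun j => by exact_mod_cast pos_of_ne hgen (hmin j)
  let M : AddSubmonoid ℤ :=
    { carrier := (Nat.cast : ℕ → ℤ) '' H
      zero_mem' := ⟨0, h0, rfl⟩
      add_mem' := by
        rintro _ _ ⟨a, ha, rfl⟩ ⟨b, hb, rfl⟩
        exact ⟨a + b, hadd a ha b hb, by push_cast; rfl⟩ }
  have hF : Frob H ∉ H := Nat.sSup_mem (compl_nonempty_of_ne hgen hmin) hfin.bddAbove
  have hFM : (Frob H : ℤ) ∉ M := by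
    rintro ⟨a, ha, e⟩
    obtain rfl : a = Frob H := by exact_mod_cast e
    exact hF ha
  have large : ∀ h : ℤ, Frob H < h → h ∈ M := by
    intro h hh
    refine ⟨h.toNat, ?_, by omega⟩
    by_contra hc
    have : h.toNat ≤ Frob H := le_csSup hfin.bddAbove hc
    omega
  have hPF : ∀ f ∈ PF H, f = Frob H := by
    obtain ⟨f, hf⟩ := Set.ncard_eq_one.1 hsym
    have hmem : (Frob H : ℤ) ∈ PF H := ⟨hFM, fun h _ hpos => large _ (by omega)⟩
    rw [hf] at hmem ⊢
    intro f' hf'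
    rw [Set.mem_singleton_iff] at hmem hf'
    rw [hf', hmem]
  refine ⟨M, fun h => ?_, pos 0, pos 1, pos 2, pos 3, fun h => ⟨fun hh hc => ?_, fun hh => ?_⟩⟩
  · constructor
    · rintro ⟨m, hm, rfl⟩
      rw [hgen] at hm
      obtain ⟨a, rfl⟩ := hm
      exact ⟨a 0, a 1, a 2, a 3, by omega, by omega, by omega, by omega, by
        rw [Fin.sum_univ_four]; push_cast; rfl⟩
    · rintro ⟨i, j, k, l, hi, hj, hk, hl, rfl⟩
      lift i to ℕ using hi
      lift j to ℕ using hj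
      lift k to ℕ using hk
      lift l to ℕ using hl
      refine ⟨i * n 0 + j * n 1 + k * n 2 + l * n 3, ?_, by push_cast; rfl⟩
      rw [hgen]
      exact ⟨![i, j, k, l], by rw [Fin.sum_univ_four]; rfl⟩
  · have := M.add_mem hh hc
    rw [add_sub_cancel] at this
    exact hFM this
  · by_contra hc
    let T : Set ℕ := {u | u ∈ H ∧ h + u ∉ M}
    have hT : T.Nonempty := ⟨0, h0, by simpa using hc⟩
    have hTb : BddAbove T := by
      refine ⟨(Frob H - h).toNat, fun u hu => ?_⟩
      by_contra! hlt
      exact hu.2 (large _ (by omega))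
    obtain ⟨hu, hu'⟩ := Nat.sSup_mem hT hTb
    have hmax : ∀ v ∈ T, v ≤ sSup T := fun v hv => le_csSup hTb hv
    generalize sSup T = u at *
    have hmem : h + u ∈ PF H := by
      refine ⟨hu', fun v hv hv0 => ?_⟩
      by_contra hcv
      have := hmax (u + v) ⟨hadd u hu v hv, by push_cast; rwa [← add_assoc]⟩
      omega
    refine hh ⟨u, hu, ?_⟩
    have := hPF _ hmem
    omega

/-- if `H = ⟨n₁,n₂,n₃,n₄⟩` is symmetric and `I_H` is not generated
by `3` elements, then some `Fr(H) + n_i` has exactly two factorizations. -/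
theorem stmt5 (n : Fin 4 → ℕ) (H : Set ℕ)
    (hH : IsNumericalSemigroup H)
    (hsym : (PF H).ncard = 1)
    (hgen : H = {m | ∃ a : Fin 4 → ℕ, m = ∑ i, a i * n i})
    (hmin : ∀ j : Fin 4, {m | ∃ a : Fin 4 → ℕ, a j = 0 ∧ m = ∑ i, a i * n i} ≠ H)
    (k : Type*) [Field k]
    (hnotCI : ¬ ∃ g : Fin 3 → MvPolynomial (Fin 4) k,
      Ideal.span (Set.range g) = RingHom.ker (MvPolynomial.aeval
        (fun i => (Polynomial.X : Polynomial k) ^ n i) :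
        MvPolynomial (Fin 4) k →ₐ[k] Polynomial k)) :
    ∃ i : Fin 4, {a : Fin 4 → ℕ | ∑ j, a j * n j = Frob H + n i}.ncard = 2 := by
  obtain ⟨M, S⟩ := exists_symmetricMonoid hH hsym hgen hmin
  rcases S.hasTwoFactorizations_or_threeRelated with h | h
  · exact h.exists_ncard_eq_two
  · exact absurd (h.exists_span_eq_ker k) hnotCI
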